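/- Let Ω ⊂ ℝ^d be a bounded open set and β : ℝ → ℝ a C¹ function with β′(s) < 0 for all s (so β is strictly monotonically decreasing). Let u, v : Ω̄ × [0,∞) → ℝ be continuous, C² in x and C¹ in t on Ω × (0,∞), with u a supersolution, ∂u/∂t ≥ −Δ_x[β(u)], and v a subsolution, ∂v/∂t ≤ −Δ_x[β(v)], on Ω × (0,∞). Assume u(x,0) > v(x,0) for all x ∈ Ω̄ and u(x,t) ≥ v(x,t) for all x ∈ ∂Ω and t ≥ 0. Then there is no point (x₀,t₀) ∈ Ω × (0,∞) with u(x₀,t₀) < v(x₀,t₀); that is, u ≥ v on Ω × (0,∞). -/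

import Mathlib

open MeasureTheory Set

/-- The Laplacian of a function on `ℝ^d`, as the sum of second partial derivatives. -/
noncomputable def laplacian {d : ℕ} (f : EuclideanSpace ℝ (Fin d) → ℝ)
    (x : EuclideanSpace ℝ (Fin d)) : ℝ :=
  ∑ i : Fin d, fderiv ℝ (fun y => fderiv ℝ f y (EuclideanSpace.single i 1)) x
    (EuclideanSpace.single i 1)

open Filter Topology

/-! ### Second differences -/

/-- Second-order Taylor expansion from the right at `0`. -/
theorem tendsto_taylor_two_right {g g' : ℝ → ℝ} {L : ℝ}
    (hg : ∀ᶠ h in 𝓝[>] (0 : ℝ), HasDerivAt g (g' h) h) (hc : ContinuousAt g 0)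
    (hg' : HasDerivAt g' L 0) :
    Tendsto (fun h => (g h - g 0 - g' 0 * h) / h ^ 2) (𝓝[>] 0) (𝓝 (L / 2)) := by
  refine HasDerivAt.lhopital_zero_nhdsGT (f' := fun h => g' h - g' 0) (g' := fun h => 2 * h)
    ?_ ?_ ?_ ?_ ?_ ?_
  · filter_upwards [hg] with h hh
    have := (hh.sub_const (g 0)).sub ((hasDerivAt_id h).const_mul (g' 0))
    exact this.congr_deriv (by simp)
  · filter_upwards with h
    simpa using hasDerivAt_pow 2 h
  · filter_upwards [self_mem_nhdsWithin] with h hh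
    have : (0 : ℝ) < h := hh
    positivity
  · have h1 : ContinuousAt (fun h => g h - g 0 - g' 0 * h) 0 := by fun_prop
    have h2 := h1.tendsto.mono_left (nhdsWithin_le_nhds (s := Ioi (0 : ℝ)))
    simpa using h2
  · have h1 : ContinuousAt (fun h : ℝ => h ^ 2) 0 := by fun_prop
    have h2 := h1.tendsto.mono_left (nhdsWithin_le_nhds (s := Ioi (0 : ℝ)))
    simpa using h2
  · have h1 := hg'.tendsto_slope.mono_left
      (nhdsWithin_mono (0 : ℝ) (fun x (hx : x ∈ Ioi (0 : ℝ)) => ne_of_gt hx))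
    refine (h1.div_const 2).congr fun h => ?_
    rw [slope_def_field, sub_zero, div_div, mul_comm]

theorem tendsto_second_difference {g g' : ℝ → ℝ} {L : ℝ}
    (hg : ∀ᶠ h in 𝓝 (0 : ℝ), HasDerivAt g (g' h) h) (hg' : HasDerivAt g' L 0) :
    Tendsto (fun h => (g h + g (-h) - 2 * g 0) / h ^ 2) (𝓝[>] 0) (𝓝 L) := by
  have hc : ContinuousAt g 0 := hg.self_of_nhds.continuousAt
  have h1 := tendsto_taylor_two_right (hg.filter_mono nhdsWithin_le_nhds) hc hg'
  have hneg : Tendsto (fun h : ℝ => -h) (𝓝 0) (𝓝 0) := by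
    simpa using (continuous_neg (G := ℝ)).tendsto 0
  have h2 : Tendsto (fun h => (g (-h) - g (-0) - (-g' (-0)) * h) / h ^ 2) (𝓝[>] 0)
      (𝓝 (L / 2)) := by
    refine tendsto_taylor_two_right (g := fun h => g (-h)) (g' := fun h => -g' (-h)) ?_ ?_ ?_
    · refine Eventually.filter_mono nhdsWithin_le_nhds ?_
      filter_upwards [hneg.eventually hg] with h hh
      have := hh.scomp h (hasDerivAt_neg h)
      exact this.congr_deriv (by simp)
    · exact ContinuousAt.comp (by simpa using hc) continuous_neg.continuousAt
    · have h3 : HasDerivAt g' L (-0) := by simpa using hg'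
      have := (h3.scomp 0 (hasDerivAt_neg 0)).neg
      exact this.congr_deriv (by simp)
  have h3 := h1.add h2
  rw [add_halves] at h3
  refine h3.congr fun h => ?_
  simp only [neg_zero]
  ring

theorem deriv_nonneg_of_min_right {g g' : ℝ → ℝ} {L : ℝ}
    (hg : ∀ᶠ h in 𝓝[>] (0 : ℝ), HasDerivAt g (g' h) h) (hc : ContinuousAt g 0)
    (hg' : HasDerivAt g' L 0) (h0 : g' 0 = 0) (hmin : ∀ᶠ h in 𝓝[>] (0 : ℝ), g 0 ≤ g h) :
    0 ≤ L := by
  have h1 := tendsto_taylor_two_right hg hc hg'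
  have : 0 ≤ L / 2 := by
    refine ge_of_tendsto h1 ?_
    filter_upwards [hmin] with h hh
    rw [h0]
    have : 0 ≤ g h - g 0 - 0 * h := by linarith
    positivity
  linarith

/-! ### Directional derivatives of a composition -/

section Directional

variable {E : Type*} [NormedAddCommGroup E] [NormedSpace ℝ E]

theorem hasDerivAt_line {f : E → ℝ} {x e : E} {h : ℝ} (hf : DifferentiableAt ℝ f (x + h • e)) :
    HasDerivAt (fun h : ℝ => f (x + h • e)) (fderiv ℝ f (x + h • e) e) h := by
  have h1 : HasDerivAt (fun h : ℝ => x + h • e) e h := by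
    simpa using ((hasDerivAt_id h).smul_const e).const_add x
  exact hf.hasFDerivAt.comp_hasDerivAt h h1

theorem tendsto_line (x e : E) : Tendsto (fun h : ℝ => x + h • e) (𝓝 0) (𝓝 x) := by
  have : Continuous (fun h : ℝ => x + h • e) := by fun_prop
  simpa using this.tendsto 0

theorem hasDerivAt_line_fderiv {f : E → ℝ} {x e : E}
    (hf : DifferentiableAt ℝ (fun y => fderiv ℝ f y e) x) :
    HasDerivAt (fun h : ℝ => fderiv ℝ f (x + h • e) e)
      (fderiv ℝ (fun y => fderiv ℝ f y e) x e) 0 := by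
  have h0 : x + (0 : ℝ) • e = x := by simp
  have := hasDerivAt_line (f := fun y => fderiv ℝ f y e) (x := x) (e := e) (h := 0)
    (by rwa [h0])
  simpa only [h0] using this

theorem eventually_hasDerivAt_line {f : E → ℝ} {x e : E}
    (hf : ∀ᶠ y in 𝓝 x, DifferentiableAt ℝ f y) :
    ∀ᶠ h in 𝓝 (0 : ℝ),
      HasDerivAt (fun h : ℝ => f (x + h • e)) (fderiv ℝ f (x + h • e) e) h :=
  ((tendsto_line x e).eventually hf).mono fun _ hh => hasDerivAt_line hh

theorem tendsto_second_difference_line {f : E → ℝ} {x e : E}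
    (hf : ∀ᶠ y in 𝓝 x, DifferentiableAt ℝ f y)
    (hf2 : DifferentiableAt ℝ (fun y => fderiv ℝ f y e) x) :
    Tendsto (fun h : ℝ => (f (x + h • e) + f (x - h • e) - 2 * f x) / h ^ 2) (𝓝[>] 0)
      (𝓝 (fderiv ℝ (fun y => fderiv ℝ f y e) x e)) := by
  have := tendsto_second_difference (eventually_hasDerivAt_line hf) (hasDerivAt_line_fderiv hf2)
  simpa [sub_eq_add_neg] using this

theorem ContDiffAt.eventually_differentiableAt {f : E → ℝ} {x : E} (hf : ContDiffAt ℝ 2 f x) :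
    ∀ᶠ y in 𝓝 x, DifferentiableAt ℝ f y :=
  (hf.eventually (by simp)).mono fun _ hy => hy.differentiableAt (by simp)

theorem ContDiffAt.differentiableAt_fderiv_apply {f : E → ℝ} {x : E} (hf : ContDiffAt ℝ 2 f x)
    (e : E) : DifferentiableAt ℝ (fun y => fderiv ℝ f y e) x :=
  ((hf.fderiv_right (m := 1) (by norm_num)).differentiableAt (by simp)).clm_apply
    (differentiableAt_const e)

variable {G : ℝ → ℝ} {u : E → ℝ} {x e : E}

theorem eventually_differentiableAt_comp (hG : Differentiable ℝ G) (hu : ContDiffAt ℝ 2 u x) :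
    ∀ᶠ y in 𝓝 x, DifferentiableAt ℝ (fun y => G (u y)) y :=
  hu.eventually_differentiableAt.mono fun y hy => (hG (u y)).fun_comp' y hy

theorem fderiv_comp_real_apply (hG : Differentiable ℝ G) {y : E} (hu : DifferentiableAt ℝ u y) :
    fderiv ℝ (fun y => G (u y)) y e = deriv G (u y) * fderiv ℝ u y e := by
  have := (hG (u y)).hasDerivAt.comp_hasFDerivAt y hu.hasFDerivAt
  have h2 : fderiv ℝ (fun y => G (u y)) y = deriv G (u y) • fderiv ℝ u y := this.fderiv
  rw [h2]; simp

theorem eventually_fderiv_comp_real (hG : Differentiable ℝ G) (hu : ContDiffAt ℝ 2 u x) (e : E) :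
    (fun y => fderiv ℝ (fun y => G (u y)) y e) =ᶠ[𝓝 x]
      fun y => deriv G (u y) * fderiv ℝ u y e :=
  hu.eventually_differentiableAt.mono fun _ hy => fderiv_comp_real_apply hG hy

theorem differentiableAt_fderiv_comp_of_outer (hG : Differentiable ℝ G) (hu : ContDiffAt ℝ 2 u x)
    (h : DifferentiableAt ℝ (deriv G) (u x)) :
    DifferentiableAt ℝ (fun y => fderiv ℝ (fun y => G (u y)) y e) x := by
  refine ((eventually_fderiv_comp_real hG hu e).differentiableAt_iff).2 ?_
  exact (h.fun_comp' x (hu.differentiableAt (by simp))).mul (hu.differentiableAt_fderiv_apply e)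

theorem DifferentiableAt.mul_of_continuousAt_of_eq_zero {a b : E → ℝ} (ha : ContinuousAt a x)
    (hb : DifferentiableAt ℝ b x) (h0 : b x = 0) : DifferentiableAt ℝ (fun y => a y * b y) x := by
  have hb' := hb.hasFDerivAt
  refine HasFDerivAt.differentiableAt (f' := a x • fderiv ℝ b x) ?_
  rw [hasFDerivAt_iff_isLittleO] at hb' ⊢
  have h1 : (fun y => a y * (b y - b x - fderiv ℝ b x (y - x))) =o[𝓝 x] fun y => y - x := by
    have := (ha.isBigO_one ℝ).mul_isLittleO hb'.norm_right
    simp only [one_mul] at this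
    exact this.of_norm_right
  have h2 : (fun y => (a y - a x) * fderiv ℝ b x (y - x)) =o[𝓝 x] fun y => y - x := by
    have h3 : (fun y => a y - a x) =o[𝓝 x] fun _ => (1 : ℝ) := by
      rw [Asymptotics.isLittleO_one_iff]
      simpa using ha.tendsto.sub_const (a x)
    have h4 : (fun y => fderiv ℝ b x (y - x)) =O[𝓝 x] fun y => ‖y - x‖ :=
      ((fderiv ℝ b x).isBigO_comp _ _).norm_right
    have := h3.mul_isBigO h4
    simp only [one_mul] at this
    exact this.of_norm_right
  refine (h1.add h2).congr_left fun y => ?_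
  simp [h0]; ring

theorem differentiableAt_fderiv_comp_of_inner (hG : Differentiable ℝ G)
    (hG' : Continuous (deriv G)) (hu : ContDiffAt ℝ 2 u x) (h : fderiv ℝ u x e = 0) :
    DifferentiableAt ℝ (fun y => fderiv ℝ (fun y => G (u y)) y e) x := by
  refine ((eventually_fderiv_comp_real hG hu e).differentiableAt_iff).2 ?_
  exact DifferentiableAt.mul_of_continuousAt_of_eq_zero
    (hG'.continuousAt.comp hu.continuousAt) (hu.differentiableAt_fderiv_apply e) h

theorem differentiableAt_deriv_of_differentiableAt_fderiv_comp (hG : Differentiable ℝ G)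
    (hu : ContDiffAt ℝ 2 u x) (he : fderiv ℝ u x e ≠ 0)
    (h : DifferentiableAt ℝ (fun y => fderiv ℝ (fun y => G (u y)) y e) x) :
    DifferentiableAt ℝ (deriv G) (u x) := by
  have hne : ∀ᶠ y in 𝓝 x, fderiv ℝ u y e ≠ 0 :=
    (hu.differentiableAt_fderiv_apply e).continuousAt.eventually_ne he
  have h1 : DifferentiableAt ℝ (fun y => deriv G (u y)) x := by
    have h2 : DifferentiableAt ℝ
        (fun y => fderiv ℝ (fun y => G (u y)) y e / fderiv ℝ u y e) x := by
      simp only [div_eq_mul_inv]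
      exact h.mul ((hu.differentiableAt_fderiv_apply e).inv he)
    refine h2.congr_of_eventuallyEq ?_
    filter_upwards [eventually_fderiv_comp_real hG hu e, hne] with y hy hy2
    rw [hy, mul_div_cancel_right₀ _ hy2]
  have h0 : x + (0 : ℝ) • e = x := by simp
  have hline : DifferentiableAt ℝ (fun h : ℝ => x + h • e) 0 := by fun_prop
  have h2 : DifferentiableAt ℝ (fun h : ℝ => deriv G (u (x + h • e))) 0 :=
    DifferentiableAt.comp (g := fun y => deriv G (u y)) (0 : ℝ) (by rwa [h0]) hline
  have hw : HasStrictDerivAt (fun h : ℝ => u (x + h • e)) (fderiv ℝ u x e) 0 := by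
    have h3 : ContDiffAt ℝ 2 (fun h : ℝ => u (x + h • e)) 0 :=
      ContDiffAt.comp (g := u) (0 : ℝ) (by rwa [h0]) (by fun_prop)
    have h4 := h3.hasStrictDerivAt (by simp)
    have h5 := hasDerivAt_line (f := u) (x := x) (e := e) (h := 0)
      (by rw [h0]; exact hu.differentiableAt (by simp))
    rw [h0] at h5
    rwa [h5.deriv] at h4
  obtain ⟨r, hinv, hri, hval⟩ : ∃ r : ℝ → ℝ, DifferentiableAt ℝ r (u x) ∧
      (∀ᶠ s in 𝓝 (u x), u (x + r s • e) = s) ∧ r (u x) = 0 := by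
    have hinv := (hw.to_localInverse he).hasDerivAt.differentiableAt
    have hri := hw.eventually_right_inverse he
    have hval := (hw.eventually_left_inverse he).self_of_nhds
    rw [h0] at hinv hri hval
    exact ⟨_, hinv, hri, hval⟩
  have h6 : DifferentiableAt ℝ (fun s => deriv G (u (x + r s • e))) (u x) :=
    DifferentiableAt.comp (g := fun h : ℝ => deriv G (u (x + h • e))) (u x)
      (by rwa [hval]) hinv
  refine h6.congr_of_eventuallyEq ?_
  filter_upwards [hri] with s hs
  rw [hs]

end Directional

/-! ### Contact with a test function -/

section Contact

variable {E : Type*} [NormedAddCommGroup E] [NormedSpace ℝ E]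

theorem deriv_nonneg_of_eventually_le_right {g : ℝ → ℝ} {g' a : ℝ} (hg : HasDerivAt g g' a)
    (h : ∀ᶠ s in 𝓝[>] a, g a ≤ g s) : 0 ≤ g' := by
  have h1 := hg.tendsto_slope.mono_left
      (nhdsWithin_mono a (fun x (hx : x ∈ Ioi a) => ne_of_gt hx))
  refine ge_of_tendsto h1 ?_
  filter_upwards [h, self_mem_nhdsWithin] with s hs hs2
  have : a < s := hs2
  rw [slope_def_field]
  exact div_nonneg (by linarith) (by linarith)

theorem deriv_nonpos_of_eventually_le_left {g : ℝ → ℝ} {g' a : ℝ} (hg : HasDerivAt g g' a)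
    (h : ∀ᶠ s in 𝓝[<] a, g a ≤ g s) : g' ≤ 0 := by
  have h1 := hg.tendsto_slope.mono_left
      (nhdsWithin_mono a (fun x (hx : x ∈ Iio a) => ne_of_lt hx))
  refine le_of_tendsto h1 ?_
  filter_upwards [h, self_mem_nhdsWithin] with s hs hs2
  have : s < a := hs2
  rw [slope_def_field]
  exact div_nonpos_of_nonneg_of_nonpos (by linarith) (by linarith)

/-- Second derivative test at a contact point which may be one-sided. When it is one-sided, the
first-order condition is recovered from the non-differentiability of `deriv G`. -/
theorem second_deriv_le_of_contact {G : ℝ → ℝ} {u : E → ℝ} {x e : E} {Φ Φ' : ℝ → ℝ} {M : ℝ}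
    (hG : Differentiable ℝ G) (hu : ContDiffAt ℝ 2 u x)
    (hΦ : ∀ h, HasDerivAt Φ (Φ' h) h) (hΦ' : HasDerivAt Φ' M 0) (h0 : Φ 0 = G (u x))
    (hge : ∀ᶠ h in 𝓝[>] (0 : ℝ), Φ h ≤ G (u (x + h • e)))
    (hcase : (∀ᶠ h in 𝓝 (0 : ℝ), Φ h ≤ G (u (x + h • e))) ∨
      (¬ DifferentiableAt ℝ (deriv G) (u x) ∧ 0 ≤ Φ' 0))
    (H : DifferentiableAt ℝ (fun y => fderiv ℝ (fun y => G (u y)) y e) x) :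
    M ≤ fderiv ℝ (fun y => fderiv ℝ (fun y => G (u y)) y e) x e := by
  have hx0 : x + (0 : ℝ) • e = x := by simp
  have hp := eventually_hasDerivAt_line (e := e) (eventually_differentiableAt_comp hG hu)
  have hp2 := hasDerivAt_line_fderiv H
  have hg : ∀ᶠ h in 𝓝 (0 : ℝ), HasDerivAt (fun h => G (u (x + h • e)) - Φ h)
      (fderiv ℝ (fun y => G (u y)) (x + h • e) e - Φ' h) h :=
    hp.mono fun h hh => hh.sub (hΦ h)
  have hg2 := hp2.sub hΦ'
  have hgv : G (u (x + (0 : ℝ) • e)) - Φ 0 = 0 := by rw [hx0, h0, sub_self]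
  have hmin : ∀ᶠ h in 𝓝[>] (0 : ℝ),
      G (u (x + (0 : ℝ) • e)) - Φ 0 ≤ G (u (x + h • e)) - Φ h := by
    filter_upwards [hge] with h hh
    rw [hgv]; linarith
  have hfirst : fderiv ℝ (fun y => G (u y)) (x + (0 : ℝ) • e) e - Φ' 0 = 0 := by
    rcases hcase with h1 | ⟨hK, h1⟩
    · have : IsLocalMin (fun h => G (u (x + h • e)) - Φ h) 0 := by
        filter_upwards [h1] with h hh
        rw [hgv]; linarith
      exact this.hasDerivAt_eq_zero hg.self_of_nhds
    · have h2 := deriv_nonneg_of_eventually_le_right hg.self_of_nhds hmin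
      have h3 : fderiv ℝ u x e = 0 := by
        by_contra h4
        exact hK (differentiableAt_deriv_of_differentiableAt_fderiv_comp hG hu h4 H)
      have h5 : fderiv ℝ (fun y => G (u y)) (x + (0 : ℝ) • e) e = 0 := by
        rw [hx0, fderiv_comp_real_apply hG (hu.differentiableAt (by simp)), h3, mul_zero]
      linarith
  have := deriv_nonneg_of_min_right (hg.filter_mono nhdsWithin_le_nhds)
    hg.self_of_nhds.continuousAt hg2 hfirst hmin
  linarith

end Contact

/-! ### The barrier profile -/

theorem hasDerivAt_max_zero_pow (n : ℕ) (s : ℝ) :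
    HasDerivAt (fun s : ℝ => max s 0 ^ (n + 2)) ((n + 2) * max s 0 ^ (n + 1)) s := by
  rcases lt_trichotomy s 0 with hs | rfl | hs
  · have : (fun s : ℝ => max s 0 ^ (n + 2)) =ᶠ[𝓝 s] fun _ => 0 := by
      filter_upwards [Iio_mem_nhds hs] with y hy
      have hy' : y ≤ 0 := le_of_lt hy
      simp [max_eq_right hy']
    rw [max_eq_right hs.le]
    simpa using (hasDerivAt_const s (0 : ℝ)).congr_of_eventuallyEq this
  · have h1 : HasDerivAt (fun s : ℝ => s * (max s 0 ^ (n + 1))) 0 0 := by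
      rw [hasDerivAt_iff_tendsto_slope]
      have hc : Continuous fun s : ℝ => max s 0 ^ (n + 1) := by fun_prop
      have h2 := (hc.tendsto 0).mono_left (nhdsWithin_le_nhds (s := {0}ᶜ))
      simp only [max_self, ne_eq, Nat.succ_ne_zero, not_false_eq_true, zero_pow] at h2
      refine h2.congr' ?_
      filter_upwards [self_mem_nhdsWithin] with y hy
      have : y ≠ 0 := hy
      simp [slope_def_field, this]
    have h3 : (fun s : ℝ => max s 0 ^ (n + 2)) = fun s : ℝ => s * (max s 0 ^ (n + 1)) := by
      funext s
      rcases le_total s 0 with h | h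
      · simp [max_eq_right h]
      · rw [max_eq_left h]; ring
    rw [h3]; simpa using h1
  · have : (fun s : ℝ => max s 0 ^ (n + 2)) =ᶠ[𝓝 s] fun s => s ^ (n + 2) := by
      filter_upwards [Ioi_mem_nhds hs] with y hy
      have hy' : 0 ≤ y := le_of_lt hy
      simp [max_eq_left hy']
    rw [max_eq_left hs.le]
    have h1 := (hasDerivAt_pow (n + 2) s).congr_of_eventuallyEq this
    exact h1.congr_deriv (by push_cast; simp)

/-- A `C²` even function, vanishing on `[-r, r]` and increasing away from it. -/
noncomputable def wellProfile (r y : ℝ) : ℝ := max (y - r) 0 ^ 3 + max (-y - r) 0 ^ 3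

/-- The derivative of `wellProfile`. -/
noncomputable def wellProfileDeriv (r y : ℝ) : ℝ :=
  3 * max (y - r) 0 ^ 2 - 3 * max (-y - r) 0 ^ 2

theorem hasDerivAt_wellProfile (r y : ℝ) :
    HasDerivAt (wellProfile r) (wellProfileDeriv r y) y := by
  have h1 := (hasDerivAt_max_zero_pow 1 (y - r)).comp y ((hasDerivAt_id y).sub_const r)
  have h2 := (hasDerivAt_max_zero_pow 1 (-y - r)).comp y ((hasDerivAt_neg y).sub_const r)
  exact (h1.add h2).congr_deriv (by simp [wellProfileDeriv]; ring)

theorem hasDerivAt_wellProfileDeriv (r y : ℝ) :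
    HasDerivAt (wellProfileDeriv r) (6 * max (y - r) 0 + 6 * max (-y - r) 0) y := by
  have h1 := (hasDerivAt_max_zero_pow 0 (y - r)).comp y ((hasDerivAt_id y).sub_const r)
  have h2 := (hasDerivAt_max_zero_pow 0 (-y - r)).comp y ((hasDerivAt_neg y).sub_const r)
  exact ((h1.const_mul 3).sub (h2.const_mul 3)).congr_deriv (by simp; ring)

theorem wellProfile_nonneg (r y : ℝ) : 0 ≤ wellProfile r y := by unfold wellProfile; positivity

theorem wellProfile_abs (r y : ℝ) : wellProfile r |y| = wellProfile r y := by
  rcases abs_cases y with ⟨h, _⟩ | ⟨h, _⟩ <;> rw [h]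
  unfold wellProfile; rw [neg_neg, add_comm]

theorem wellProfile_zero {r : ℝ} (hr : 0 ≤ r) : wellProfile r 0 = 0 := by
  simp [wellProfile, hr]

theorem continuous_wellProfile (r : ℝ) : Continuous (wellProfile r) := by
  unfold wellProfile; fun_prop

theorem wellProfile_of_nonneg {r y : ℝ} (hr : 0 ≤ r) (hy : 0 ≤ y) :
    wellProfile r y = max (y - r) 0 ^ 3 := by
  have : -y - r ≤ 0 := by linarith
  simp [wellProfile, max_eq_right this]

theorem wellProfile_le_of_abs_le {r y z : ℝ} (hr : 0 ≤ r) (h : |y| ≤ |z|) :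
    wellProfile r y ≤ wellProfile r z := by
  rw [← wellProfile_abs r y, ← wellProfile_abs r z, wellProfile_of_nonneg hr (abs_nonneg y),
    wellProfile_of_nonneg hr (abs_nonneg z)]
  gcongr

theorem abs_le_of_wellProfile_le {r y : ℝ} (hr : 0 < r) (h : wellProfile r y ≤ r ^ 3) :
    |y| ≤ 2 * r := by
  rw [← wellProfile_abs, wellProfile_of_nonneg hr.le (abs_nonneg y)] at h
  have := le_of_pow_le_pow_left₀ (by norm_num) hr.le h
  have := le_max_left (|y| - r) 0
  linarith

theorem wellProfile_move_toward {r b h : ℝ} (hr : 0 < r) (hb : 0 ≤ b) (h0 : 0 ≤ h) (hh : h ≤ r) :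
    wellProfile r (b - h) ≤ wellProfile r b := by
  rcases le_total h b with hhb | hhb
  · apply wellProfile_le_of_abs_le hr.le
    rw [abs_of_nonneg hb, abs_of_nonneg (by linarith)]; linarith
  · have h1 : wellProfile r (b - h) = 0 := by
      have : b - h - r ≤ 0 := by linarith
      have h2 : -(b - h) - r ≤ 0 := by linarith
      simp only [wellProfile, max_eq_right this, max_eq_right h2]; norm_num
    rw [h1]; exact wellProfile_nonneg r b

theorem cubic_sub_quartic_le {b m : ℝ} (hb : 0 < b) (hm : 0 ≤ m) :
    6 * m - 9 * (144 / b ^ 3) * m ^ 4 ≤ b := by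
  by_cases h : 6 * m ≤ b
  · have : 0 ≤ 9 * (144 / b ^ 3) * m ^ 4 := by positivity
    linarith
  · push Not at h
    have h1 : b ^ 3 ≤ (6 * m) ^ 3 := by gcongr
    have h2 : 6 * m ≤ 9 * (144 / b ^ 3) * m ^ 4 := by
      have : 9 * (144 / b ^ 3) * m ^ 4 = 1296 * m ^ 4 / b ^ 3 := by ring
      rw [this, le_div_iff₀ (by positivity)]
      nlinarith [pow_nonneg hm 4, mul_le_mul_of_nonneg_left h1 hm]
    linarith

/-! ### Sub- and supersolutions -/

/-- `u` is a supersolution of `∂u/∂t = Δ (G ∘ u)` on `Ω × (0, ∞)`, with separate regularity. -/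
structure IsSuper {d : ℕ} (Ω : Set (EuclideanSpace ℝ (Fin d))) (G : ℝ → ℝ)
    (u : EuclideanSpace ℝ (Fin d) → ℝ → ℝ) : Prop where
  cont : ContinuousOn (fun p : EuclideanSpace ℝ (Fin d) × ℝ => u p.1 p.2)
    (closure Ω ×ˢ Ici (0 : ℝ))
  space : ∀ t, 0 < t → ∀ x ∈ Ω, ContDiffAt ℝ 2 (fun y => u y t) x
  time : ∀ x ∈ Ω, ∀ t, 0 < t → DifferentiableAt ℝ (u x) t
  ineq : ∀ x ∈ Ω, ∀ t, 0 < t → laplacian (fun y => G (u y t)) x ≤ deriv (u x) t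

/-- `v` is a subsolution of `∂v/∂t = Δ (G ∘ v)` on `Ω × (0, ∞)`, with separate regularity. -/
structure IsSub {d : ℕ} (Ω : Set (EuclideanSpace ℝ (Fin d))) (G : ℝ → ℝ)
    (v : EuclideanSpace ℝ (Fin d) → ℝ → ℝ) : Prop where
  cont : ContinuousOn (fun p : EuclideanSpace ℝ (Fin d) × ℝ => v p.1 p.2)
    (closure Ω ×ˢ Ici (0 : ℝ))
  space : ∀ t, 0 < t → ∀ x ∈ Ω, ContDiffAt ℝ 2 (fun y => v y t) x
  time : ∀ x ∈ Ω, ∀ t, 0 < t → DifferentiableAt ℝ (v x) t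
  ineq : ∀ x ∈ Ω, ∀ t, 0 < t → deriv (v x) t ≤ laplacian (fun y => G (v y t)) x

theorem laplacian_neg {d : ℕ} (f : EuclideanSpace ℝ (Fin d) → ℝ) (x : EuclideanSpace ℝ (Fin d)) :
    laplacian (fun y => -f y) x = -laplacian f x := by
  simp [laplacian, fderiv_fun_neg, Finset.sum_neg_distrib]

/-- The nonlinearity satisfied by `-u`. -/
def oddReflect (G : ℝ → ℝ) (s : ℝ) : ℝ := -G (-s)

theorem IsSuper.neg {d : ℕ} {Ω : Set (EuclideanSpace ℝ (Fin d))} {G : ℝ → ℝ}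
    {u : EuclideanSpace ℝ (Fin d) → ℝ → ℝ} (h : IsSuper Ω G u) :
    IsSub Ω (oddReflect G) (fun x t => -u x t) where
  cont := h.cont.neg
  space t ht x hx := (h.space t ht x hx).neg
  time x hx t ht := (h.time x hx t ht).neg
  ineq x hx t ht := by
    have := h.ineq x hx t ht
    have h2 : deriv (fun t => -u x t) t = -deriv (u x) t := deriv.fun_neg
    simp only [oddReflect, neg_neg]
    rw [laplacian_neg, h2]; linarith

theorem IsSub.neg {d : ℕ} {Ω : Set (EuclideanSpace ℝ (Fin d))} {G : ℝ → ℝ}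
    {u : EuclideanSpace ℝ (Fin d) → ℝ → ℝ} (h : IsSub Ω G u) :
    IsSuper Ω (oddReflect G) (fun x t => -u x t) where
  cont := h.cont.neg
  space t ht x hx := (h.space t ht x hx).neg
  time x hx t ht := (h.time x hx t ht).neg
  ineq x hx t ht := by
    have := h.ineq x hx t ht
    have h2 : deriv (fun t => -u x t) t = -deriv (u x) t := deriv.fun_neg
    simp only [oddReflect, neg_neg]
    rw [laplacian_neg, h2]; linarith

theorem deriv_oddReflect (G : ℝ → ℝ) (s : ℝ) : deriv (oddReflect G) s = deriv G (-s) := by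
  have : oddReflect G = fun s => -(G (-s)) := rfl
  rw [this, deriv.fun_neg, deriv_comp_neg, neg_neg]

theorem ContDiff.oddReflect {G : ℝ → ℝ} (hG : ContDiff ℝ 1 G) : ContDiff ℝ 1 (oddReflect G) :=
  (hG.comp contDiff_neg).neg

theorem not_differentiableAt_deriv_oddReflect {G : ℝ → ℝ} {k : ℝ}
    (h : ¬ DifferentiableAt ℝ (deriv G) k) :
    ¬ DifferentiableAt ℝ (deriv (oddReflect G)) (-k) := by
  intro h2
  apply h
  have h3 : deriv G = fun s => deriv (_root_.oddReflect G) (-s) := by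
    funext s; rw [deriv_oddReflect, neg_neg]
  rw [h3]
  exact DifferentiableAt.fun_comp' (f := fun s => -s) k h2 (by fun_prop)

/-! ### Persistence of singular levels -/

section Persist

variable {d : ℕ} {Ω : Set (EuclideanSpace ℝ (Fin d))} {G : ℝ → ℝ}
  {u : EuclideanSpace ℝ (Fin d) → ℝ → ℝ} {k : ℝ} {x₀ : EuclideanSpace ℝ (Fin d)}

/-- The well around `x₀`. -/
noncomputable def well (r : ℝ) (x₀ x : EuclideanSpace ℝ (Fin d)) : ℝ :=
  ∑ i, wellProfile r (x i - x₀ i)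

theorem well_nonneg (r : ℝ) (x₀ x : EuclideanSpace ℝ (Fin d)) : 0 ≤ well r x₀ x :=
  Finset.sum_nonneg fun _ _ => wellProfile_nonneg _ _

theorem well_self {r : ℝ} (hr : 0 ≤ r) (x₀ : EuclideanSpace ℝ (Fin d)) : well r x₀ x₀ = 0 := by
  simp [well, wellProfile_zero hr]

theorem continuous_well (r : ℝ) (x₀ : EuclideanSpace ℝ (Fin d)) : Continuous (well r x₀) := by
  unfold well
  refine continuous_finsetSum _ fun i _ => (continuous_wellProfile r).comp ?_
  fun_prop

theorem norm_le_of_abs_apply_le {c : ℝ} (x : EuclideanSpace ℝ (Fin d))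
    (h : ∀ i, |x i| ≤ c) : ‖x‖ ≤ d * c := by
  have h1 : x = ∑ i, x i • EuclideanSpace.single i (1 : ℝ) := by
    ext j
    simp [Finset.sum_apply, Pi.single_apply]
  calc ‖x‖ = ‖∑ i, x i • EuclideanSpace.single i (1 : ℝ)‖ := by rw [← h1]
    _ ≤ ∑ i, ‖x i • EuclideanSpace.single i (1 : ℝ)‖ := norm_sum_le _ _
    _ ≤ ∑ _i : Fin d, c := by
        refine Finset.sum_le_sum fun i _ => ?_
        simpa [norm_smul] using h i
    _ = d * c := by simp

theorem dist_le_of_well_le {r : ℝ} (hr : 0 < r) {x₀ x : EuclideanSpace ℝ (Fin d)}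
    (h : well r x₀ x ≤ r ^ 3) : dist x x₀ ≤ d * (2 * r) := by
  rw [dist_eq_norm]
  refine norm_le_of_abs_apply_le _ fun i => ?_
  refine abs_le_of_wellProfile_le hr (le_trans ?_ h)
  exact Finset.single_le_sum (f := fun i => wellProfile r (x i - x₀ i))
    (fun _ _ => wellProfile_nonneg _ _) (Finset.mem_univ i)

theorem well_add_smul_single (r : ℝ) (x₀ x : EuclideanSpace ℝ (Fin d)) (i : Fin d) (s : ℝ) :
    well r x₀ (x + s • EuclideanSpace.single i 1) =
      well r x₀ x - wellProfile r (x i - x₀ i) + wellProfile r (x i - x₀ i + s) := by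
  unfold well
  rw [← Finset.add_sum_erase _ _ (Finset.mem_univ i),
    ← Finset.add_sum_erase (f := fun i => wellProfile r (x i - x₀ i)) _ (Finset.mem_univ i)]
  have h1 : ∀ j ∈ Finset.univ.erase i,
      wellProfile r ((x + s • EuclideanSpace.single i (1 : ℝ)) j - x₀ j) =
        wellProfile r (x j - x₀ j) := by
    intro j hj
    have : j ≠ i := Finset.ne_of_mem_erase hj
    simp [this]
  rw [Finset.sum_congr rfl h1]
  have h2 : (x + s • EuclideanSpace.single i (1 : ℝ)) i - x₀ i = x i - x₀ i + s := by
    simp; ring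
  rw [h2]; ring

/-- There is a unit direction `σ • eᵢ`, `σ = ±1`, pointing towards the centre. -/
theorem exists_sign_well (r : ℝ) (x₀ x : EuclideanSpace ℝ (Fin d)) (i : Fin d) :
    ∃ σ : ℝ, σ ^ 2 = 1 ∧ ∀ h : ℝ,
      well r x₀ (x + h • σ • EuclideanSpace.single i (1 : ℝ)) =
        well r x₀ x - wellProfile r |x i - x₀ i| + wellProfile r (|x i - x₀ i| - h) := by
  rcases abs_cases (x i - x₀ i) with ⟨h, _⟩ | ⟨h, _⟩
  · refine ⟨-1, by norm_num, fun s => ?_⟩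
    rw [smul_smul, well_add_smul_single, h]; ring_nf
  · refine ⟨1, by norm_num, fun s => ?_⟩
    rw [smul_smul, well_add_smul_single, h]
    congr 1
    · rw [← h, wellProfile_abs]
    · rw [← wellProfile_abs, ← wellProfile_abs r (-_ - s), ← abs_neg]; ring_nf

/-- At a contact point with the barrier each term of the Laplacian is bounded below. -/
theorem barrier_second_deriv {w : EuclideanSpace ℝ (Fin d) → ℝ} {x : EuclideanSpace ℝ (Fin d)}
    {r ε N A b : ℝ} (hr : 0 < r) (hε : 0 < ε) (hN : 0 < N)
    (hb : ∀ m : ℝ, 0 ≤ m → 6 * m - 9 * N * m ^ 4 ≤ b) (hb0 : 0 ≤ b)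
    (hG : Differentiable ℝ G) (hk : ¬ DifferentiableAt ℝ (deriv G) k)
    (hinj : Function.Injective G)
    (hw : ContDiffAt ℝ 2 w x) (hA : well r x₀ x ≤ A)
    (heq : G (w x) = G k + ε * (Real.exp (N * (A - well r x₀ x)) - 1))
    (hge : ∀ y, well r x₀ y ≤ A → G k + ε * (Real.exp (N * (A - well r x₀ y)) - 1) ≤ G (w y))
    (i : Fin d) :
    -(ε * N * Real.exp (N * (A - well r x₀ x)) * b) ≤
      fderiv ℝ (fun y => fderiv ℝ (fun y => G (w y)) y (EuclideanSpace.single i 1)) x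
        (EuclideanSpace.single i 1) := by
  by_cases H : DifferentiableAt ℝ
      (fun y => fderiv ℝ (fun y => G (w y)) y (EuclideanSpace.single i 1)) x
  swap
  · rw [fderiv_zero_of_not_differentiableAt H]
    simp only [zero_apply]
    have : 0 ≤ ε * N * Real.exp (N * (A - well r x₀ x)) * b := by positivity
    linarith
  obtain ⟨σ, hσ, hwell⟩ := exists_sign_well r x₀ x i
  set e := EuclideanSpace.single i (1 : ℝ) with he
  set c := |x i - x₀ i| with hc
  set D := A - well r x₀ x with hD
  set Φ : ℝ → ℝ := fun h =>
    G k + ε * (Real.exp (N * (D + wellProfile r c - wellProfile r (c - h))) - 1) with hΦdef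
  set Φ' : ℝ → ℝ := fun h =>
    ε * (Real.exp (N * (D + wellProfile r c - wellProfile r (c - h))) *
      (N * wellProfileDeriv r (c - h))) with hΦ'def
  have hwp : ∀ h, HasDerivAt (fun h => wellProfile r (c - h)) (-wellProfileDeriv r (c - h)) h := by
    intro h
    have := (hasDerivAt_wellProfile r (c - h)).comp h ((hasDerivAt_id h).const_sub c)
    exact this.congr_deriv (by ring)
  have hexp : ∀ h, HasDerivAt
      (fun h => Real.exp (N * (D + wellProfile r c - wellProfile r (c - h))))
      (Real.exp (N * (D + wellProfile r c - wellProfile r (c - h))) *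
        (N * wellProfileDeriv r (c - h))) h := by
    intro h
    have := (((hwp h).const_sub (D + wellProfile r c)).const_mul N).exp
    exact this.congr_deriv (by ring)
  have hΦd : ∀ h, HasDerivAt Φ (Φ' h) h := fun h =>
    (((hexp h).sub_const 1).const_mul ε).const_add (G k)
  have hc0 : 0 ≤ c := abs_nonneg _
  set m := max (c - r) 0 with hm
  have hm0 : 0 ≤ m := le_max_right _ _
  have hmr : max (-c - r) 0 = 0 := max_eq_right (by linarith)
  have hΦd' : HasDerivAt Φ' (ε * (Real.exp (N * D) * (N * (3 * m ^ 2)) * (N * (3 * m ^ 2)) +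
      Real.exp (N * D) * (N * -(6 * m)))) 0 := by
    have h1 : HasDerivAt (fun h => wellProfileDeriv r (c - h)) (-(6 * m)) 0 := by
      have := (hasDerivAt_wellProfileDeriv r (c - 0)).comp 0 ((hasDerivAt_id (0 : ℝ)).const_sub c)
      refine this.congr_deriv ?_
      simp only [sub_zero, hmr, ← hm]; ring
    have h2 := ((hexp 0).mul (h1.const_mul N)).const_mul ε
    refine h2.congr_deriv ?_
    simp only [sub_zero, add_sub_cancel_right, wellProfileDeriv, hmr, ← hm]; ring
  have hwc : ∀ h, A - well r x₀ (x + h • σ • e) = D + wellProfile r c - wellProfile r (c - h) := by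
    intro h; rw [hwell, hD]; ring
  have hH : DifferentiableAt ℝ (fun y => fderiv ℝ (fun y => G (w y)) y (σ • e)) x := by
    simpa only [map_smul] using H.fun_const_smul σ
  have key := second_deriv_le_of_contact (G := G) (u := w) (x := x) (e := σ • e) hG hw hΦd hΦd'
    (by simp [hΦdef, heq]) ?_ ?_ hH
  · have h3 : fderiv ℝ (fun y => fderiv ℝ (fun y => G (w y)) y (σ • e)) x (σ • e) =
        fderiv ℝ (fun y => fderiv ℝ (fun y => G (w y)) y e) x e := by
      simp only [map_smul, smul_eq_mul]
      rw [fderiv_const_mul H]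
      simp only [smul_apply, smul_eq_mul]
      rw [← mul_assoc, ← sq, hσ, one_mul]
    rw [h3] at key
    refine le_trans ?_ key
    have h4 := mul_le_mul_of_nonneg_left (hb m hm0)
      (show 0 ≤ ε * N * Real.exp (N * D) by positivity)
    linarith [h4]
  · have hev : ∀ᶠ h in 𝓝[>] (0 : ℝ), h ≤ r :=
      Filter.Eventually.filter_mono nhdsWithin_le_nhds (Iic_mem_nhds hr)
    filter_upwards [self_mem_nhdsWithin, hev] with h hh hhr
    have h5 := wellProfile_move_toward hr hc0 (le_of_lt hh) hhr
    have h6 := hwc h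
    have h7 := hge (x + h • σ • e) (by linarith)
    rw [h6] at h7
    exact h7
  · rcases hA.lt_or_eq with hlt | heqA
    · left
      have hcont : ContinuousAt (fun h : ℝ => well r x₀ (x + h • σ • e)) 0 := by
        refine ((continuous_well r x₀).comp ?_).continuousAt
        fun_prop
      have : ∀ᶠ h : ℝ in 𝓝 0, well r x₀ (x + h • σ • e) < A := by
        apply hcont.eventually_lt_const
        simpa using hlt
      filter_upwards [this] with h hh
      have h7 := hge (x + h • σ • e) hh.le
      rw [hwc h] at h7
      exact h7
    · right
      have hD0 : D = 0 := by rw [hD, heqA, sub_self]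
      refine ⟨?_, ?_⟩
      · have : w x = k := by
          apply hinj; rw [heq, hD0]; simp
        rwa [this]
      · simp only [hΦ'def, sub_zero, wellProfileDeriv, hmr]
        have : (0 : ℝ) ≤ 3 * max (c - r) 0 ^ 2 - 3 * 0 ^ 2 := by simp
        positivity

end Persist

section Persist

variable {d : ℕ} {Ω : Set (EuclideanSpace ℝ (Fin d))} {G : ℝ → ℝ}
  {u v : EuclideanSpace ℝ (Fin d) → ℝ → ℝ} {k : ℝ} {x₀ : EuclideanSpace ℝ (Fin d)}

/-- A supersolution cannot cross downwards a level at which `deriv G` is not differentiable: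
across such a level the (junk) Laplacian gives no diffusion. -/
theorem IsSuper.persist (hΩ : IsOpen Ω) (hG : ContDiff ℝ 1 G) (hG' : ∀ s, 0 < deriv G s)
    (hu : IsSuper Ω G u) (hk : ¬ DifferentiableAt ℝ (deriv G) k) (hx₀ : x₀ ∈ Ω)
    (h0 : k < u x₀ 0) {t₁ : ℝ} (ht₁ : 0 < t₁) : k ≤ u x₀ t₁ := by
  by_contra! hcon
  have hmono : StrictMono G := strictMono_of_deriv_pos hG'
  have hGd : Differentiable ℝ G := hG.differentiable (by simp)
  set k' := (k + u x₀ 0) / 2 with hk'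
  have hkk' : k < k' := by linarith
  have hu0 : ContinuousAt (fun y => u y 0) x₀ := by
    have h1 : ContinuousOn (fun y => u y 0) (closure Ω) :=
      hu.cont.comp (f := fun y => (y, (0 : ℝ))) (by fun_prop) fun y hy => ⟨hy, mem_Ici.2 le_rfl⟩
    exact h1.continuousAt (mem_of_superset (hΩ.mem_nhds hx₀) subset_closure)
  obtain ⟨R, hR, hball⟩ : ∃ R > 0, ∀ y ∈ Metric.closedBall x₀ R, y ∈ Ω ∧ k' < u y 0 := by
    have h1 : ∀ᶠ y in 𝓝 x₀, y ∈ Ω ∧ k' < u y 0 :=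
      (hΩ.eventually_mem hx₀).and (hu0.eventually (lt_mem_nhds (by rw [hk']; linarith)))
    obtain ⟨R, hR, h⟩ := Metric.nhds_basis_closedBall.eventually_iff.1 h1
    exact ⟨R, hR, fun y hy => h hy⟩
  set r := R / (2 * (d + 1)) with hr
  have hr0 : 0 < r := by positivity
  set A₀ := r ^ 3 with hA₀
  have hA₀0 : 0 < A₀ := by positivity
  set V := A₀ / (2 * t₁) with hV
  have hV0 : 0 < V := by positivity
  have hVt : V * t₁ = A₀ / 2 := by rw [hV]; field_simp
  set C : Set (EuclideanSpace ℝ (Fin d) × ℝ) :=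
    {p | p.2 ∈ Icc 0 t₁ ∧ well r x₀ p.1 ≤ A₀ - V * p.2} with hC
  have hwell : ∀ p ∈ C, p.1 ∈ Metric.closedBall x₀ R := by
    intro p hp
    have h1 : well r x₀ p.1 ≤ r ^ 3 := by
      have h2 := mul_nonneg hV0.le hp.1.1
      have h3 := hp.2
      rw [← hA₀]; linarith
    have h2 := dist_le_of_well_le hr0 h1
    have h3 : d * (2 * r) ≤ R := by
      rw [hr, mul_div_assoc', mul_div_assoc', div_le_iff₀ (by positivity)]
      nlinarith
    exact h2.trans h3
  have hCΩ : ∀ p ∈ C, p.1 ∈ Ω := fun p hp => (hball _ (hwell p hp)).1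
  have hCc : IsCompact C := by
    refine ((isCompact_closedBall x₀ R).prod (isCompact_Icc (a := (0 : ℝ)) (b := t₁))
      ).of_isClosed_subset ?_ fun p hp => ⟨hwell p hp, hp.1⟩
    refine (isClosed_Icc.preimage continuous_snd).inter ?_
    exact isClosed_le ((continuous_well r x₀).comp continuous_fst) (by fun_prop)
  have huC : ContinuousOn (fun p : EuclideanSpace ℝ (Fin d) × ℝ => u p.1 p.2) C :=
    hu.cont.mono fun p hp => ⟨subset_closure (hCΩ p hp), hp.1.1⟩
  obtain ⟨g₁, hg₁, hbd⟩ : ∃ g₁ > 0, ∀ p ∈ C, deriv G (u p.1 p.2) ≤ g₁ := by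
    have h1 : ContinuousOn (fun p : EuclideanSpace ℝ (Fin d) × ℝ => deriv G (u p.1 p.2)) C :=
      (hG.continuous_deriv (by simp)).comp_continuousOn huC
    obtain ⟨g, hg⟩ := hCc.exists_bound_of_continuousOn h1
    refine ⟨|g| + 1, by positivity, fun p hp => ?_⟩
    have := (le_abs_self _).trans (hg p hp)
    linarith [le_abs_self g]
  set b := V / (2 * g₁ * (d + 1)) with hb
  have hb0 : 0 < b := by positivity
  set N := 144 / b ^ 3 with hN
  have hN0 : 0 < N := by positivity
  set ε := (G k' - G k) / Real.exp (N * A₀) with hε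
  have hε0 : 0 < ε := div_pos (by linarith [hmono hkk']) (Real.exp_pos _)
  have hεe : ε * Real.exp (N * A₀) = G k' - G k := by
    rw [hε]; field_simp
  set bar : EuclideanSpace ℝ (Fin d) → ℝ → ℝ := fun x t =>
    G k + ε * (Real.exp (N * (A₀ - V * t - well r x₀ x)) - 1) with hbar
  have hbarc : Continuous (fun p : EuclideanSpace ℝ (Fin d) × ℝ => bar p.1 p.2) := by
    have := (continuous_well r x₀).comp (continuous_fst (X := EuclideanSpace ℝ (Fin d)) (Y := ℝ))
    simp only [hbar]
    fun_prop
  have hinit : ∀ p ∈ C, p.2 = 0 → bar p.1 p.2 < G (u p.1 p.2) := by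
    intro p hp hp0
    have h1 := hmono (hball _ (hwell p hp)).2
    have h2 : Real.exp (N * (A₀ - V * 0 - well r x₀ p.1)) ≤ Real.exp (N * A₀) := by
      gcongr; linarith [well_nonneg r x₀ p.1]
    have h3 := mul_le_mul_of_nonneg_left h2 hε0.le
    rw [hp0]
    simp only [hbar]
    nlinarith
  set S := C ∩ (fun p : EuclideanSpace ℝ (Fin d) × ℝ => G (u p.1 p.2) - bar p.1 p.2) ⁻¹' Iic 0
    with hS
  have hScont : ContinuousOn
      (fun p : EuclideanSpace ℝ (Fin d) × ℝ => G (u p.1 p.2) - bar p.1 p.2) C :=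
    (hG.continuous.comp_continuousOn huC).sub hbarc.continuousOn
  have hSc : IsCompact S :=
    hCc.of_isClosed_subset (hScont.preimage_isClosed_of_isClosed hCc.isClosed isClosed_Iic)
      inter_subset_left
  have hSne : S.Nonempty := by
    refine ⟨(x₀, t₁), ⟨⟨ht₁.le, le_rfl⟩, ?_⟩, ?_⟩
    · simp only [well_self hr0.le]; linarith
    · simp only [mem_preimage, mem_Iic, hbar, well_self hr0.le, sub_zero]
      have h1 : 1 ≤ Real.exp (N * (A₀ - V * t₁)) :=
        Real.one_le_exp (mul_nonneg hN0.le (by linarith))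
      nlinarith [hmono hcon]
  obtain ⟨⟨x, t⟩, hxS, hmin⟩ := hSc.exists_isMinOn hSne continuous_snd.continuousOn
  have hxC : (x, t) ∈ C := hxS.1
  have hxle : G (u x t) ≤ bar x t := by
    have := hxS.2
    simp only [mem_preimage, mem_Iic] at this; linarith
  have ht0 : 0 < t := by
    rcases hxC.1.1.lt_or_eq with h | h
    · exact h
    · have := hinit _ hxC h.symm
      exact absurd hxle (not_le.2 this)
  have hbefore : ∀ y s, 0 ≤ s → s < t → well r x₀ y ≤ A₀ - V * s → bar y s < G (u y s) := by
    intro y s hs hst hy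
    by_contra! h
    have hmem : (y, s) ∈ S := by
      refine ⟨⟨⟨hs, hst.le.trans hxC.1.2⟩, hy⟩, ?_⟩
      simp only [mem_preimage, mem_Iic]; linarith
    have := hmin hmem
    simp only [mem_ofPred_eq] at this
    linarith
  have hevs : ∀ᶠ s in 𝓝[<] t, 0 ≤ s ∧ s < t :=
    (Filter.Eventually.filter_mono nhdsWithin_le_nhds (Ici_mem_nhds ht0)).and
      self_mem_nhdsWithin
  have hnow : ∀ y, well r x₀ y ≤ A₀ - V * t → bar y t ≤ G (u y t) := by
    intro y hy
    have hyC : (y, t) ∈ C := ⟨hxC.1, hy⟩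
    have hdu : ContinuousAt (fun s => G (u y s) - bar y s) t := by
      refine ContinuousAt.sub ?_ ?_
      · exact hG.continuous.continuousAt.comp (hu.time y (hCΩ _ hyC) t ht0).continuousAt
      · exact (hbarc.comp (f := fun s : ℝ => (y, s)) (by fun_prop)).continuousAt
    have : 0 ≤ G (u y t) - bar y t := by
      refine ge_of_tendsto (hdu.tendsto.mono_left (nhdsWithin_le_nhds (s := Iio t))) ?_
      filter_upwards [hevs] with s hs
      have := hbefore y s hs.1 hs.2 (by nlinarith [hs.2])
      linarith
    linarith
  have heq : G (u x t) = bar x t := le_antisymm hxle (hnow x hxC.2)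
  have hterm := barrier_second_deriv (G := G) (k := k) (x₀ := x₀) (w := fun y => u y t) (x := x)
    (A := A₀ - V * t) hr0 hε0 hN0 (b := b) (fun m hm => cubic_sub_quartic_le hb0 hm) hb0.le hGd hk
    hmono.injective (hu.space t ht0 x (hCΩ _ hxC)) hxC.2 heq hnow
  set Ex := Real.exp (N * (A₀ - V * t - well r x₀ x)) with hEx
  have hEx0 : 0 < Ex := Real.exp_pos _
  have hlap : -(d * (ε * N * Ex * b)) ≤ deriv (u x) t := by
    refine le_trans ?_ (hu.ineq x (hCΩ _ hxC) t ht0)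
    calc -(d * (ε * N * Ex * b)) = ∑ _i : Fin d, -(ε * N * Ex * b) := by simp
      _ ≤ _ := Finset.sum_le_sum fun i _ => hterm i
  have htime : deriv G (u x t) * deriv (u x) t ≤ -(ε * N * V * Ex) := by
    have h1 : HasDerivAt (fun s => G (u x s)) (deriv G (u x t) * deriv (u x) t) t :=
      (hGd (u x t)).hasDerivAt.comp t (hu.time x (hCΩ _ hxC) t ht0).hasDerivAt
    have h2 : HasDerivAt (fun s => bar x s) (-(ε * N * V * Ex)) t := by
      have h3 : HasDerivAt (fun s => N * (A₀ - V * s - well r x₀ x)) (N * (-V)) t := by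
        have := ((((hasDerivAt_id t).const_mul V).const_sub A₀).sub_const
          (well r x₀ x)).const_mul N
        exact this.congr_deriv (by ring)
      exact (((h3.exp.sub_const 1).const_mul ε).const_add (G k)).congr_deriv (by ring)
    have h4 := deriv_nonpos_of_eventually_le_left (h1.sub h2) (by
      filter_upwards [hevs] with s hs
      have := hbefore x s hs.1 hs.2 (by nlinarith [hs.2, hxC.2])
      simp only [Pi.sub_apply, heq]
      linarith)
    linarith
  have hgp := hG' (u x t)
  have hgb := hbd _ hxC
  have h5 : deriv G (u x t) * -(d * (ε * N * Ex * b)) ≤ -(ε * N * V * Ex) :=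
    (mul_le_mul_of_nonneg_left hlap hgp.le).trans htime
  have h6 : ε * N * Ex * V ≤ ε * N * Ex * (g₁ * d * b) := by
    have : deriv G (u x t) * (d * (ε * N * Ex * b)) ≤ g₁ * (d * (ε * N * Ex * b)) := by
      gcongr
    linarith
  have h7 := le_of_mul_le_mul_left h6 (by positivity)
  have h8 : g₁ * (d + 1) * b = V / 2 := by rw [hb]; field_simp
  nlinarith [mul_pos hg₁ hb0]

theorem IsSub.persist (hΩ : IsOpen Ω) (hG : ContDiff ℝ 1 G) (hG' : ∀ s, 0 < deriv G s)
    (hv : IsSub Ω G v) (hk : ¬ DifferentiableAt ℝ (deriv G) k) (hx₀ : x₀ ∈ Ω)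
    (h0 : v x₀ 0 < k) {t₁ : ℝ} (ht₁ : 0 < t₁) : v x₀ t₁ ≤ k := by
  have := hv.neg.persist hΩ hG.oddReflect (fun s => by rw [deriv_oddReflect]; exact hG' _)
    (not_differentiableAt_deriv_oddReflect hk) hx₀ (neg_lt_neg h0) ht₁
  exact neg_le_neg_iff.1 this

end Persist

section Status

variable {d : ℕ} {Ω : Set (EuclideanSpace ℝ (Fin d))} {G : ℝ → ℝ}
  {u v : EuclideanSpace ℝ (Fin d) → ℝ → ℝ}

/-- Where a supersolution has dropped below a subsolution that started below it, its Laplacian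
is not a junk value. -/
theorem IsSuper.differentiableAt_fderiv_of_lt (hΩ : IsOpen Ω) (hG : ContDiff ℝ 1 G)
    (hG' : ∀ s, 0 < deriv G s) (hu : IsSuper Ω G u) (hv : IsSub Ω G v)
    {x y : EuclideanSpace ℝ (Fin d)} {t s : ℝ} (hx : x ∈ Ω) (hy : y ∈ Ω) (ht : 0 < t)
    (hs : 0 < s) (h0 : v y 0 < u x 0) (h : u x t < v y s) (e : EuclideanSpace ℝ (Fin d)) :
    DifferentiableAt ℝ (fun z => fderiv ℝ (fun z => G (u z t)) z e) x := by
  by_contra H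
  have hGd : Differentiable ℝ G := hG.differentiable (by simp)
  have hsp := hu.space t ht x hx
  have hk : ¬ DifferentiableAt ℝ (deriv G) (u x t) := fun hk =>
    H (differentiableAt_fderiv_comp_of_outer hGd hsp hk)
  have he : fderiv ℝ (fun z => u z t) x e ≠ 0 := fun he =>
    H (differentiableAt_fderiv_comp_of_inner hGd (hG.continuous_deriv (by simp)) hsp he)
  have hfreq : ∃ᶠ z in 𝓝 x, u z t < u x t := by
    intro hmin
    have : IsLocalMin (fun z => u z t) x := hmin.mono fun z hz => not_lt.1 hz
    exact he (by rw [this.fderiv_eq_zero]; simp)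
  have hev : ∀ᶠ z in 𝓝 x, z ∈ Ω ∧ v y 0 < u z 0 := by
    have h1 : ContinuousOn (fun z => u z 0) (closure Ω) :=
      hu.cont.comp (f := fun z => (z, (0 : ℝ))) (by fun_prop) fun z hz => ⟨hz, mem_Ici.2 le_rfl⟩
    have h2 := h1.continuousAt (mem_of_superset (hΩ.mem_nhds hx) subset_closure)
    exact (hΩ.eventually_mem hx).and (h2.eventually (lt_mem_nhds h0))
  obtain ⟨z, hz, hzΩ, hz0⟩ := (hfreq.and_eventually hev).exists
  rcases lt_or_ge (u x t) (u z 0) with h1 | h1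
  · exact absurd (hu.persist hΩ hG hG' hk hzΩ h1 ht) (not_le.2 hz)
  · exact absurd (hv.persist hΩ hG hG' hk hy (hz0.trans_le h1) hs) (not_le.2 h)

/-- Discrete Laplacian with step `h`. -/
noncomputable def discLap (h : ℝ) (f : EuclideanSpace ℝ (Fin d) → ℝ)
    (x : EuclideanSpace ℝ (Fin d)) : ℝ :=
  ∑ i, (f (x + h • EuclideanSpace.single i 1) + f (x - h • EuclideanSpace.single i 1) - 2 * f x)
    / h ^ 2

theorem tendsto_discLap {f : EuclideanSpace ℝ (Fin d) → ℝ} {x : EuclideanSpace ℝ (Fin d)}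
    (hf : ∀ᶠ y in 𝓝 x, DifferentiableAt ℝ f y)
    (hf2 : ∀ e, DifferentiableAt ℝ (fun y => fderiv ℝ f y e) x) :
    Tendsto (fun h => discLap h f x) (𝓝[>] 0) (𝓝 (laplacian f x)) :=
  tendsto_finsetSum _ fun _ _ => tendsto_second_difference_line hf (hf2 _)

end Status

/-! ### The discrete torsion function -/

section Torsion

variable {d : ℕ}

/-- Average over the `2 * d` neighbours at distance `h`. -/
noncomputable def nbrAvg (h : ℝ) (f : EuclideanSpace ℝ (Fin d) → ℝ)
    (x : EuclideanSpace ℝ (Fin d)) : ℝ :=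
  (∑ i, (f (x + h • EuclideanSpace.single i 1) + f (x - h • EuclideanSpace.single i 1))) / (2 * d)

theorem discLap_eq_nbrAvg (hd : 0 < d) (h : ℝ) (f : EuclideanSpace ℝ (Fin d) → ℝ)
    (x : EuclideanSpace ℝ (Fin d)) :
    discLap h f x = 2 * d / h ^ 2 * (nbrAvg h f x - f x) := by
  have hd' : (d : ℝ) ≠ 0 := by positivity
  unfold discLap nbrAvg
  rw [← Finset.sum_div, Finset.sum_sub_distrib]
  simp only [Finset.sum_const, Finset.card_univ, Fintype.card_fin, nsmul_eq_mul]
  field_simp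

theorem nbrAvg_mono {h : ℝ} {f g : EuclideanSpace ℝ (Fin d) → ℝ} {x : EuclideanSpace ℝ (Fin d)}
    (hfg : ∀ y, dist y x ≤ |h| → f y ≤ g y) : nbrAvg h f x ≤ nbrAvg h g x := by
  unfold nbrAvg
  gcongr with i
  · apply hfg; simp [norm_smul]
  · apply hfg; simp [norm_smul]

theorem nbrAvg_paraboloid (hd : 0 < d) (h c : ℝ) (x₁ x : EuclideanSpace ℝ (Fin d)) :
    nbrAvg h (fun y => (c - ‖y - x₁‖ ^ 2) / (2 * d)) x =
      (c - ‖x - x₁‖ ^ 2) / (2 * d) - h ^ 2 / (2 * d) := by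
  have hd' : (d : ℝ) ≠ 0 := by positivity
  have h1 : ∀ i : Fin d, ‖x + h • EuclideanSpace.single i (1 : ℝ) - x₁‖ ^ 2 +
      ‖x - h • EuclideanSpace.single i (1 : ℝ) - x₁‖ ^ 2 = 2 * (‖x - x₁‖ ^ 2 + h ^ 2) := by
    intro i
    have := parallelogram_law_with_norm ℝ (x - x₁) (h • EuclideanSpace.single i (1 : ℝ))
    have h2 : ‖h • EuclideanSpace.single i (1 : ℝ)‖ ^ 2 = h ^ 2 := by simp [norm_smul]
    rw [add_sub_right_comm, sub_right_comm, this, h2]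
  unfold nbrAvg
  have h3 : ∀ i : Fin d, (c - ‖x + h • EuclideanSpace.single i (1 : ℝ) - x₁‖ ^ 2) / (2 * d) +
      (c - ‖x - h • EuclideanSpace.single i (1 : ℝ) - x₁‖ ^ 2) / (2 * d) =
      (c - ‖x - x₁‖ ^ 2 - h ^ 2) / d := by
    intro i
    rw [← add_div, div_eq_div_iff (by positivity) hd']
    linear_combination -(d : ℝ) * h1 i
  simp only [h3, Finset.sum_const, Finset.card_univ, Fintype.card_fin, nsmul_eq_mul]
  field_simp

/-- One step of the iteration converging to the discrete torsion function. -/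
noncomputable def torsionStep (Ω : Set (EuclideanSpace ℝ (Fin d))) (h : ℝ)
    (f : EuclideanSpace ℝ (Fin d) → ℝ) : EuclideanSpace ℝ (Fin d) → ℝ :=
  Ω.indicator fun x => nbrAvg h f x + h ^ 2 / (2 * d)

theorem torsionStep_mono {Ω : Set (EuclideanSpace ℝ (Fin d))} {h : ℝ}
    {f g : EuclideanSpace ℝ (Fin d) → ℝ} (hfg : f ≤ g) :
    torsionStep Ω h f ≤ torsionStep Ω h g := by
  intro x
  refine indicator_le_indicator ?_
  gcongr
  exact nbrAvg_mono fun y _ => hfg y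

theorem measurable_torsionStep {Ω : Set (EuclideanSpace ℝ (Fin d))} (hΩ : MeasurableSet Ω) {h : ℝ}
    {f : EuclideanSpace ℝ (Fin d) → ℝ} (hf : Measurable f) : Measurable (torsionStep Ω h f) := by
  refine Measurable.indicator ?_ hΩ
  unfold nbrAvg
  refine ((Finset.measurable_fun_sum _ fun i _ => ?_).div_const _).add_const _
  exact (hf.comp (by fun_prop)).add (hf.comp (by fun_prop))

theorem exists_torsion (hd : 0 < d) {h : ℝ} (h0 : 0 < h) (h1 : h ≤ 1)
    {Ω : Set (EuclideanSpace ℝ (Fin d))} (hΩ : MeasurableSet Ω) {x₁ : EuclideanSpace ℝ (Fin d)}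
    {ρ R : ℝ} (hρ : 0 < ρ) (hρΩ : Metric.ball x₁ (2 * ρ) ⊆ Ω)
    (hΩR : Ω ⊆ Metric.closedBall x₁ R) (hρR : 2 * ρ ≤ R) :
    ∃ ψ : EuclideanSpace ℝ (Fin d) → ℝ, Measurable ψ ∧ (∀ x, 0 ≤ ψ x) ∧
      (∀ x, ψ x ≤ (R + 1) ^ 2 / (2 * d)) ∧ (∀ x, x ∉ Ω → ψ x = 0) ∧
      (∀ x ∈ Ω, discLap h ψ x = -1) ∧ ∀ x ∈ Metric.ball x₁ ρ, 3 * ρ ^ 2 / (2 * d) ≤ ψ x := by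
  have hd' : (0 : ℝ) < d := by positivity
  have hR : 0 < R := by linarith
  set para : ℝ → EuclideanSpace ℝ (Fin d) → ℝ := fun c y => (c - ‖y - x₁‖ ^ 2) / (2 * d)
    with hpara
  set s : EuclideanSpace ℝ (Fin d) → ℝ := fun y => max (para ((2 * ρ) ^ 2) y) 0 with hs
  set S : EuclideanSpace ℝ (Fin d) → ℝ := fun y => max (para ((R + 1) ^ 2) y) 0 with hS
  set F : ℕ → EuclideanSpace ℝ (Fin d) → ℝ := fun n => (torsionStep Ω h)^[n] s with hF
  have hFsucc : ∀ n, F (n + 1) = torsionStep Ω h (F n) := fun n =>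
    Function.iterate_succ_apply' _ _ _
  have hs1 : s ≤ torsionStep Ω h s := by
    intro x
    by_cases hx : x ∈ Ω
    · simp only [torsionStep, indicator_of_mem hx]
      refine max_le ?_ ?_
      · have := nbrAvg_mono (h := h) (x := x) (f := para ((2 * ρ) ^ 2)) (g := s)
          fun y _ => le_max_left _ _
        rw [nbrAvg_paraboloid hd] at this
        simp only [hpara]; linarith
      · have := nbrAvg_mono (h := h) (x := x) (f := fun _ => 0) (g := s) fun y _ => le_max_right _ _
        simp only [nbrAvg, add_zero, Finset.sum_const_zero, zero_div] at this
        have h3 : 0 ≤ h ^ 2 / (2 * d) := by positivity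
        simp only [nbrAvg]; linarith
    · simp only [torsionStep, indicator_of_notMem hx]
      refine max_le ?_ le_rfl
      have : ¬ dist x x₁ < 2 * ρ := fun hlt => hx (hρΩ hlt)
      rw [dist_eq_norm, not_lt] at this
      have h2 : (2 * ρ) ^ 2 ≤ ‖x - x₁‖ ^ 2 := by gcongr
      exact div_nonpos_of_nonpos_of_nonneg (by linarith) (by positivity)
  have hS1 : torsionStep Ω h S ≤ S := by
    intro x
    by_cases hx : x ∈ Ω
    · simp only [torsionStep, indicator_of_mem hx]
      have := nbrAvg_mono (h := h) (x := x) (f := S) (g := para ((R + 1) ^ 2)) fun y hy => by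
        refine max_le le_rfl (div_nonneg ?_ (by positivity))
        have h2 : ‖y - x₁‖ ≤ R + 1 := by
          rw [← dist_eq_norm]
          have h3 : dist x x₁ ≤ R := hΩR hx
          rw [abs_of_pos h0] at hy
          linarith [dist_triangle y x x₁]
        have : ‖y - x₁‖ ^ 2 ≤ (R + 1) ^ 2 := by gcongr
        linarith
      rw [nbrAvg_paraboloid hd] at this
      refine le_trans ?_ (le_max_left _ _)
      simp only [hpara] at this ⊢; linarith
    · simp only [torsionStep, indicator_of_notMem hx]
      exact le_max_right _ _
  have hmono : Monotone F := by
    refine monotone_nat_of_le_succ fun n => ?_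
    induction n with
    | zero => exact hs1
    | succ n ih => rw [hFsucc, hFsucc]; exact torsionStep_mono ih
  have hFS : ∀ n, F n ≤ S := by
    intro n
    induction n with
    | zero =>
      intro x
      refine max_le_max ?_ le_rfl
      simp only [hpara]
      gcongr; linarith
    | succ n ih => rw [hFsucc]; exact (torsionStep_mono ih).trans hS1
  have hFoff : ∀ n x, x ∉ Ω → F n x = 0 := by
    intro n x hx
    refine le_antisymm ?_ ((le_max_right _ _).trans (hmono (Nat.zero_le n) x))
    refine (hmono (Nat.le_succ n) x).trans ?_
    simp [hFsucc, torsionStep, hx]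
  have hSle : ∀ x, S x ≤ (R + 1) ^ 2 / (2 * d) := by
    intro x
    refine max_le ?_ (by positivity)
    simp only [hpara]
    gcongr
    linarith [sq_nonneg ‖x - x₁‖]
  have hbdd : ∀ x, BddAbove (range fun n => F n x) := by
    intro x
    refine ⟨S x, ?_⟩
    rintro _ ⟨n, rfl⟩
    exact hFS n x
  set ψ : EuclideanSpace ℝ (Fin d) → ℝ := fun x => ⨆ n, F n x with hψ
  have hlim : ∀ x, Tendsto (fun n => F n x) atTop (𝓝 (ψ x)) := fun x =>
    tendsto_atTop_ciSup (fun m n hmn => hmono hmn x) (hbdd x)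
  have hsψ : ∀ x, s x ≤ ψ x := fun x => le_ciSup (hbdd x) 0
  have hmeas : ∀ n, Measurable (F n) := by
    intro n
    induction n with
    | zero =>
      have : Continuous s := by simp only [hs, hpara]; fun_prop
      exact this.measurable
    | succ n ih => rw [hFsucc]; exact measurable_torsionStep hΩ ih
  refine ⟨ψ, measurable_of_tendsto_metrizable hmeas (tendsto_pi_nhds.2 hlim),
    fun x => (le_max_right _ _).trans (hsψ x), fun x => ciSup_le fun n => (hFS n x).trans (hSle x),
    fun x hx => ?_, fun x hx => ?_, fun x hx => ?_⟩
  · simp [hψ, hFoff _ x hx]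
  · have h2 : Tendsto (fun n => F (n + 1) x) atTop (𝓝 (nbrAvg h ψ x + h ^ 2 / (2 * d))) := by
      simp only [hFsucc, torsionStep, indicator_of_mem hx, nbrAvg]
      refine (Tendsto.div_const (tendsto_finsetSum _ fun i _ => ?_) _).add_const _
      exact (hlim _).add (hlim _)
    have h3 := tendsto_nhds_unique ((tendsto_add_atTop_iff_nat 1).2 (hlim x)) h2
    rw [discLap_eq_nbrAvg hd, h3]
    field_simp
    ring
  · refine le_trans ?_ ((le_max_left _ _).trans (hsψ x))
    simp only [hpara]
    gcongr
    have h2 : ‖x - x₁‖ ≤ ρ := by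
      rw [← dist_eq_norm]; exact le_of_lt hx
    have : ‖x - x₁‖ ^ 2 ≤ ρ ^ 2 := by gcongr
    linarith

theorem integral_add_sub_two_mul_div {α : Type*} [MeasurableSpace α] {μ : Measure α}
    {A B C : α → ℝ} {c : ℝ} (hA : Integrable A μ) (hB : Integrable B μ) (hC : Integrable C μ) :
    ∫ x, (A x + B x - 2 * C x) / c ∂μ = (∫ x, A x ∂μ + ∫ x, B x ∂μ - 2 * ∫ x, C x ∂μ) / c := by
  have hAB : Integrable (fun x => A x + B x) μ := hA.add hB
  rw [integral_div, integral_sub hAB (hC.const_mul 2), integral_add hA hB, integral_const_mul]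

theorem integral_mul_discLap {h : ℝ} {ψ Z : EuclideanSpace ℝ (Fin d) → ℝ} {c : ℝ}
    (hψ : Integrable ψ) (hZ : Measurable Z) (hZc : ∀ x, |Z x| ≤ c) :
    Integrable (fun x => ψ x * discLap h Z x) ∧ Integrable (fun x => Z x * discLap h ψ x) ∧
      ∫ x, ψ x * discLap h Z x = ∫ x, Z x * discLap h ψ x := by
  have hi1 : ∀ a : EuclideanSpace ℝ (Fin d), Integrable (fun x => ψ x * Z (x + a)) := fun a =>
    hψ.mul_bdd (hZ.comp (measurable_add_const a)).aestronglyMeasurable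
      (Eventually.of_forall fun x => hZc (x + a))
  have hi2 : ∀ a : EuclideanSpace ℝ (Fin d), Integrable (fun x => Z x * ψ (x + a)) := fun a =>
    (hψ.comp_add_right a).bdd_mul hZ.aestronglyMeasurable (Eventually.of_forall fun x => hZc _)
  have hshift : ∀ a : EuclideanSpace ℝ (Fin d),
      ∫ x, ψ x * Z (x + a) = ∫ x, Z x * ψ (x + -a) := by
    intro a
    rw [← integral_add_right_eq_self (fun x => Z x * ψ (x + -a)) a]
    simp [mul_comm]
  have e1 : ∀ x, ψ x * discLap h Z x = ∑ i : Fin d, (ψ x * Z (x + h • EuclideanSpace.single i 1) +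
      ψ x * Z (x + -(h • EuclideanSpace.single i 1)) - 2 * (ψ x * Z (x + 0))) / h ^ 2 := by
    intro x
    rw [discLap, Finset.mul_sum]
    refine Finset.sum_congr rfl fun i _ => ?_
    rw [add_zero, ← sub_eq_add_neg]; ring
  have e2 : ∀ x, Z x * discLap h ψ x = ∑ i : Fin d, (Z x * ψ (x + h • EuclideanSpace.single i 1) +
      Z x * ψ (x + -(h • EuclideanSpace.single i 1)) - 2 * (Z x * ψ (x + 0))) / h ^ 2 := by
    intro x
    rw [discLap, Finset.mul_sum]
    refine Finset.sum_congr rfl fun i _ => ?_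
    rw [add_zero, ← sub_eq_add_neg]; ring
  have i1 : ∀ i ∈ (Finset.univ : Finset (Fin d)), Integrable (fun x =>
      (ψ x * Z (x + h • EuclideanSpace.single i 1) +
      ψ x * Z (x + -(h • EuclideanSpace.single i 1)) - 2 * (ψ x * Z (x + 0))) / h ^ 2) :=
    fun i _ => (((hi1 _).add (hi1 _)).sub ((hi1 0).const_mul 2)).div_const _
  have i2 : ∀ i ∈ (Finset.univ : Finset (Fin d)), Integrable (fun x =>
      (Z x * ψ (x + h • EuclideanSpace.single i 1) +
      Z x * ψ (x + -(h • EuclideanSpace.single i 1)) - 2 * (Z x * ψ (x + 0))) / h ^ 2) :=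
    fun i _ => (((hi2 _).add (hi2 _)).sub ((hi2 0).const_mul 2)).div_const _
  simp only [e1, e2]
  refine ⟨integrable_finsetSum _ i1, integrable_finsetSum _ i2, ?_⟩
  rw [integral_finsetSum _ i1, integral_finsetSum _ i2]
  refine Finset.sum_congr rfl fun i _ => ?_
  rw [integral_add_sub_two_mul_div (hi1 _) (hi1 _) (hi1 _),
    integral_add_sub_two_mul_div (hi2 _) (hi2 _) (hi2 _), hshift, hshift, hshift]
  rw [neg_neg, neg_zero]
  ring

/-- Testing the discrete Laplacian of a function which is small outside `Ω` against the torsion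
function. -/
theorem integral_torsion_mul_discLap_le {h e c : ℝ} {Ω : Set (EuclideanSpace ℝ (Fin d))}
    (hΩ : MeasurableSet Ω) (hΩf : volume Ω ≠ ⊤) {ψ Z : EuclideanSpace ℝ (Fin d) → ℝ}
    (hψ : Integrable ψ) (hψ0 : ∀ x, 0 ≤ ψ x) (hψoff : ∀ x, x ∉ Ω → ψ x = 0)
    (hψlap : ∀ x ∈ Ω, discLap h ψ x = -1) (hZ : Measurable Z) (hZ0 : ∀ x, 0 ≤ Z x)
    (hZc : ∀ x, Z x ≤ c)
    (hZe : ∀ x, x ∉ Ω → (∃ y ∈ Ω, dist x y ≤ |h|) → Z x ≤ e) :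
    Integrable (fun x => ψ x * discLap h Z x) ∧
      ∫ x, ψ x * discLap h Z x ≤ e * volume.real Ω := by
  obtain ⟨j1, j2, j3⟩ := integral_mul_discLap (h := h) hψ hZ
    (fun x => by rw [abs_of_nonneg (hZ0 x)]; exact hZc x)
  obtain ⟨-, k2, k3⟩ := integral_mul_discLap (h := h) (Z := fun _ => 1) (c := 1) hψ
    measurable_const (by simp)
  have k4 : ∫ x, discLap h ψ x = 0 := by
    simp only [one_mul] at k3
    rw [← k3]
    have : ∀ x, discLap h (fun _ : EuclideanSpace ℝ (Fin d) => (1 : ℝ)) x = 0 := by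
      intro x; simp [discLap]; norm_num
    simp [this]
  simp only [one_mul] at k2
  refine ⟨j1, ?_⟩
  rw [j3]
  have hind : Integrable (Ω.indicator (1 : EuclideanSpace ℝ (Fin d) → ℝ)) :=
    (integrable_indicator_iff hΩ).2 (integrableOn_const hΩf)
  have hle : ∀ x, Z x * discLap h ψ x ≤ e * (discLap h ψ x + Ω.indicator (1 : EuclideanSpace ℝ (Fin d) → ℝ) x) := by
    intro x
    by_cases hx : x ∈ Ω
    · rw [hψlap x hx, indicator_of_mem hx, Pi.one_apply]
      linarith [hZ0 x]
    · rw [indicator_of_notMem hx, add_zero]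
      have hnn : 0 ≤ discLap h ψ x := by
        unfold discLap
        rw [hψoff x hx]
        refine Finset.sum_nonneg fun i _ => div_nonneg ?_ (sq_nonneg h)
        have := hψ0 (x + h • EuclideanSpace.single i 1)
        have := hψ0 (x - h • EuclideanSpace.single i 1)
        linarith
      by_cases hn : ∃ y ∈ Ω, dist x y ≤ |h|
      · exact mul_le_mul_of_nonneg_right (hZe x hx hn) hnn
      · have : discLap h ψ x = 0 := by
          unfold discLap
          refine Finset.sum_eq_zero fun i _ => ?_
          push Not at hn
          rw [hψoff x hx, hψoff, hψoff]
          · simp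
          · intro hm
            have := hn _ hm
            simp [norm_smul] at this
          · intro hm
            have := hn _ hm
            simp [norm_smul] at this
        rw [this]; simp
  calc ∫ x, Z x * discLap h ψ x
      ≤ ∫ x, e * (discLap h ψ x + Ω.indicator (1 : EuclideanSpace ℝ (Fin d) → ℝ) x) :=
        integral_mono j2 ((k2.add hind).const_mul e) hle
    _ = e * volume.real Ω := by
        rw [integral_const_mul, integral_add k2 hind, k4, integral_indicator_one hΩ, zero_add]

end Torsion

/-! ### A weighted `L¹` estimate -/

section WeightedEstimate

variable {d : ℕ}

theorem backward_difference_max_le {X X' h B z : ℝ} {f : EuclideanSpace ℝ (Fin d) → ℝ}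
    {x : EuclideanSpace ℝ (Fin d)} (hh : 0 < h) (hf : f x = z) (hpos : 0 < X ↔ 0 < z)
    (hB : 0 ≤ B) (hXB : 0 < z → (X - X') / h - discLap h f x ≤ B) :
    (max X 0 - max X' 0) / h ≤ B + discLap h (fun y => max (f y) 0) x := by
  by_cases hz : 0 < z
  · have h1 : discLap h f x ≤ discLap h (fun y => max (f y) 0) x := by
      unfold discLap
      gcongr with i
      · exact le_max_left _ _
      · exact le_max_left _ _
      · simp only [hf]; exact (max_eq_left hz.le).le
    have h2 : (max X 0 - max X' 0) / h ≤ (X - X') / h := by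
      gcongr
      · exact (max_eq_left (hpos.2 hz).le).le
      · exact le_max_left _ _
    linarith [hXB hz]
  · have hX : X ≤ 0 := not_lt.1 fun h => hz (hpos.1 h)
    have h1 : 0 ≤ discLap h (fun y => max (f y) 0) x := by
      unfold discLap
      refine Finset.sum_nonneg fun i _ => div_nonneg ?_ (sq_nonneg h)
      have h2 : max (f x) 0 = 0 := max_eq_right (by rw [hf]; exact not_lt.1 hz)
      simp only [h2]
      have := le_max_right (f (x + h • EuclideanSpace.single i 1)) 0
      have := le_max_right (f (x - h • EuclideanSpace.single i 1)) 0
      linarith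
    have h2 : (max X 0 - max X' 0) / h ≤ 0 := by
      rw [max_eq_right hX]
      exact div_nonpos_of_nonpos_of_nonneg (by linarith [le_max_right X' 0]) hh.le
    linarith

theorem integral_discLap {z : EuclideanSpace ℝ (Fin d) → ℝ → ℝ} {a b : ℝ}
    (hz : ∀ x, Continuous (z x)) (h : ℝ) (x : EuclideanSpace ℝ (Fin d)) :
    ∫ t in a..b, discLap h (fun y => z y t) x = discLap h (fun y => ∫ t in a..b, z y t) x := by
  unfold discLap
  have hi : ∀ y, IntervalIntegrable (z y) volume a b := fun y => (hz y).intervalIntegrable a b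
  rw [intervalIntegral.integral_finsetSum]
  · refine Finset.sum_congr rfl fun i _ => ?_
    rw [intervalIntegral.integral_div, intervalIntegral.integral_sub ((hi _).add (hi _))
      ((hi _).const_mul 2), intervalIntegral.integral_add (hi _) (hi _),
      intervalIntegral.integral_const_mul]
  · intro i _
    exact (((hi _).add (hi _)).sub ((hi _).const_mul 2)).div_const _

theorem le_integral_backward_difference {W : ℝ → ℝ} (hW : Continuous W)
    {t₁ T h h₀ w : ℝ} (hh : 0 < h) (hh₀ : h ≤ h₀) (hinit : ∀ t ∈ Icc (t₁ - h₀) t₁, W t = 0)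
    (hw : ∀ t ∈ Icc (T - h₀) T, w ≤ W t) :
    w ≤ ∫ t in t₁..T, (W t - W (t - h)) / h := by
  have hi : ∀ a b, IntervalIntegrable W volume a b := fun a b => hW.intervalIntegrable a b
  have hi' : IntervalIntegrable (fun t => W (t - h)) volume t₁ T :=
    (hW.comp (continuous_sub_right h)).intervalIntegrable _ _
  rw [intervalIntegral.integral_div, intervalIntegral.integral_sub (hi _ _) hi',
    intervalIntegral.integral_comp_sub_right,
    intervalIntegral.integral_interval_sub_interval_comm (hi _ _) (hi _ _) (hi _ _),
    intervalIntegral.integral_symm (t₁ - h) t₁, intervalIntegral.integral_symm (T - h) T]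
  have h1 : ∫ t in (t₁ - h)..t₁, W t = 0 := by
    rw [intervalIntegral.integral_congr (g := fun _ => 0)]
    · simp
    · intro t ht
      rw [uIcc_of_le (by linarith)] at ht
      exact hinit t ⟨by linarith [ht.1], ht.2⟩
  have h2 : w * h ≤ ∫ t in (T - h)..T, W t := by
    have := intervalIntegral.integral_mono_on (a := T - h) (b := T) (μ := volume) (f := fun _ => w)
      (g := W) (by linarith) (by simp) (hi _ _)
      fun t ht => hw t ⟨by linarith [ht.1], ht.2⟩
    simp only [intervalIntegral.integral_const, sub_sub_cancel, smul_eq_mul] at this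
    linarith
  rw [h1, le_div_iff₀ hh]
  linarith

theorem weighted_l1_estimate (hd : 0 < d) {Ω : Set (EuclideanSpace ℝ (Fin d))}
    (hΩ : MeasurableSet Ω) {x₁ : EuclideanSpace ℝ (Fin d)} {ρ R : ℝ} (hρ : 0 < ρ)
    (hρΩ : Metric.ball x₁ (2 * ρ) ⊆ Ω) (hΩR : Ω ⊆ Metric.closedBall x₁ R) (hρR : 2 * ρ ≤ R)
    {X z : EuclideanSpace ℝ (Fin d) → ℝ → ℝ} (hX : Continuous (Function.uncurry X))
    (hz : Continuous (Function.uncurry z)) (hpos : ∀ x t, 0 < X x t ↔ 0 < z x t)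
    {t₁ T e h₀ w C Cz : ℝ} (ht : t₁ ≤ T) (he : 0 ≤ e) (hh₀ : 0 < h₀) (hw0 : 0 ≤ w)
    (hzC : ∀ x t, z x t ≤ Cz)
    (hineq : ∀ x ∈ Ω, ∀ t ∈ Icc t₁ T, 0 < z x t → ∀ ε > 0, ∀ᶠ h in 𝓝[>] (0 : ℝ),
      (X x t - X x (t - h)) / h - discLap h (fun y => z y t) x ≤ ε)
    (hbdd : ∀ x ∈ Ω, ∀ t ∈ Icc t₁ T, 0 < z x t → ∀ h, 0 < h → h ≤ h₀ →
      (X x t - X x (t - h)) / h - discLap h (fun y => z y t) x ≤ C)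
    (hinit : ∀ x ∈ Ω, ∀ t ∈ Icc (t₁ - h₀) t₁, X x t ≤ 0)
    (houter : ∀ x, x ∉ Ω → (∃ y ∈ Ω, dist x y ≤ h₀) → ∀ t ∈ Icc t₁ T, z x t ≤ e)
    (hw : ∀ x ∈ Metric.ball x₁ ρ, ∀ t ∈ Icc (T - h₀) T, w ≤ X x t) :
    3 * ρ ^ 2 / (2 * d) * w * volume.real (Metric.ball x₁ ρ) ≤ e * (T - t₁) * volume.real Ω := by
  have hΩf : volume Ω ≠ ⊤ :=
    ((measure_mono hΩR).trans_lt measure_closedBall_lt_top).ne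
  have hdc : ∀ h, Continuous (fun p : EuclideanSpace ℝ (Fin d) × ℝ =>
      discLap h (fun y => z y p.2) p.1) := by
    intro h
    unfold discLap
    refine continuous_finsetSum _ fun i _ => Continuous.div_const ?_ _
    refine ((hz.comp (f := fun p : EuclideanSpace ℝ (Fin d) × ℝ =>
      (p.1 + h • EuclideanSpace.single i (1 : ℝ), p.2)) (by fun_prop)).add
      (hz.comp (f := fun p : EuclideanSpace ℝ (Fin d) × ℝ =>
      (p.1 - h • EuclideanSpace.single i (1 : ℝ), p.2)) (by fun_prop))).sub (hz.const_mul 2)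
  set err : ℝ → EuclideanSpace ℝ (Fin d) × ℝ → ℝ := fun h p => if 0 < z p.1 p.2 then
    max ((X p.1 p.2 - X p.1 (p.2 - h)) / h - discLap h (fun y => z y p.2) p.1) 0 else 0 with herr
  have herr0 : ∀ h p, 0 ≤ err h p := by
    intro h p; simp only [herr]; split_ifs
    · exact le_max_right _ _
    · exact le_rfl
  have herrm : ∀ h, Measurable (err h) := by
    intro h
    refine Measurable.ite (isOpen_lt continuous_const hz).measurableSet ?_ measurable_const
    have h1 : Continuous fun p : EuclideanSpace ℝ (Fin d) × ℝ => X p.1 (p.2 - h) :=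
      hX.comp (f := fun p : EuclideanSpace ℝ (Fin d) × ℝ => (p.1, p.2 - h)) (by fun_prop)
    exact ((((hX.sub h1).div_const h).sub (hdc h)).max continuous_const).measurable
  have herrC : ∀ h, 0 < h → h ≤ h₀ → ∀ x ∈ Ω, ∀ t ∈ Icc t₁ T, err h (x, t) ≤ max C 0 := by
    intro h hh hhh x hx t ht
    simp only [herr]; split_ifs with h1
    · exact max_le_max (hbdd x hx t ht h1 h hh hhh) le_rfl
    · exact le_max_right _ _
  set Cψ := (R + 1) ^ 2 / (2 * d) with hCψ
  set ζ : EuclideanSpace ℝ (Fin d) → ℝ → ℝ := fun x t => max (z x t) 0 with hζ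
  have hζc : Continuous (Function.uncurry ζ) := hz.max continuous_const
  have hζx : ∀ x, Continuous (ζ x) := fun x =>
    hζc.comp (f := fun t => (x, t)) (by fun_prop)
  set Z : EuclideanSpace ℝ (Fin d) → ℝ := fun x => ∫ t in t₁..T, ζ x t with hZ
  have hZc : Continuous Z := intervalIntegral.continuous_parametric_intervalIntegral_of_continuous'
    hζc t₁ T
  have hZle : ∀ x c, (∀ t ∈ Icc t₁ T, ζ x t ≤ c) → Z x ≤ c * (T - t₁) := by
    intro x c hc
    have := intervalIntegral.integral_mono_on (μ := volume) (f := ζ x) (g := fun _ => c) ht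
      ((hζx x).intervalIntegrable _ _) (by simp) hc
    simp only [intervalIntegral.integral_const, smul_eq_mul] at this
    linarith
  have hstep : ∀ h, 0 < h → h ≤ h₀ → h ≤ 1 →
      3 * ρ ^ 2 / (2 * d) * w * volume.real (Metric.ball x₁ ρ) ≤
        (Cψ * ∫ x in Ω, ∫ t in Ioc t₁ T, err h (x, t)) + e * (T - t₁) * volume.real Ω := by
    intro h hh hhh hh1
    obtain ⟨ψ, hψm, hψ0, hψC, hψoff, hψlap, hψρ⟩ :=
      exists_torsion hd hh hh1 hΩ hρ hρΩ hΩR hρR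
    have hψi : Integrable ψ := by
      have : ψ = Ω.indicator ψ := by
        funext x
        by_cases hx : x ∈ Ω
        · rw [indicator_of_mem hx]
        · rw [indicator_of_notMem hx, hψoff x hx]
      rw [this, integrable_indicator_iff hΩ]
      refine Measure.integrableOn_of_bounded hΩf hψm.aestronglyMeasurable (M := Cψ) ?_
      refine Eventually.of_forall fun x => ?_
      rw [Real.norm_of_nonneg (hψ0 x)]; exact hψC x
    obtain ⟨hint, hle⟩ := integral_torsion_mul_discLap_le (Z := Z) (h := h) (e := e * (T - t₁))
      (c := max Cz 0 * (T - t₁)) hΩ hΩf hψi hψ0 hψoff hψlap hZc.measurable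
      (fun x => intervalIntegral.integral_nonneg ht fun t _ => le_max_right _ _)
      (fun x => hZle x _ fun t _ => max_le_max (hzC x t) le_rfl)
      (fun x hx ⟨y, hy, hxy⟩ => hZle x _ fun t ht' =>
        max_le (houter x hx ⟨y, hy, hxy.trans (by rw [abs_of_pos hh]; exact hhh)⟩ t ht') he)
    have hpt : ∀ x ∈ Ω, (Metric.ball x₁ ρ).indicator (fun _ => w) x ≤
        (∫ t in Ioc t₁ T, err h (x, t)) + discLap h Z x := by
      intro x hx
      have hWc : Continuous (fun t => max (X x t) 0) :=
        (hX.comp (f := fun t => (x, t)) (by fun_prop)).max continuous_const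
      have h1 : (Metric.ball x₁ ρ).indicator (fun _ => w) x ≤
          ∫ t in t₁..T, (max (X x t) 0 - max (X x (t - h)) 0) / h := by
        refine le_integral_backward_difference hWc hh hhh
          (fun t ht' => max_eq_right (hinit x hx t ht')) fun t ht' => ?_
        by_cases hxb : x ∈ Metric.ball x₁ ρ
        · rw [indicator_of_mem hxb]; exact (hw x hxb t ht').trans (le_max_left _ _)
        · rw [indicator_of_notMem hxb]; exact le_max_right _ _
      have hei : IntervalIntegrable (fun t => err h (x, t)) volume t₁ T := by
        rw [intervalIntegrable_iff_integrableOn_Ioc_of_le ht]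
        refine Measure.integrableOn_of_bounded (M := max C 0) (by simp)
          ((herrm h).comp (by fun_prop)).aestronglyMeasurable ?_
        filter_upwards [ae_restrict_mem measurableSet_Ioc] with t ht'
        rw [Real.norm_of_nonneg (herr0 _ _)]
        exact herrC h hh hhh x hx t ⟨ht'.1.le, ht'.2⟩
      have hdi : IntervalIntegrable (fun t => discLap h (fun y => ζ y t) x) volume t₁ T := by
        refine Continuous.intervalIntegrable ?_ _ _
        unfold discLap
        exact continuous_finsetSum _ fun i _ => Continuous.div_const
          (((hζx _).add (hζx _)).sub ((hζx _).const_mul 2)) _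
      refine h1.trans ?_
      rw [hZ, ← integral_discLap hζx, ← intervalIntegral.integral_of_le ht,
        ← intervalIntegral.integral_add hei hdi]
      refine intervalIntegral.integral_mono_on ht ?_ (hei.add hdi) fun t ht' => ?_
      · refine Continuous.intervalIntegrable ?_ _ _
        exact (hWc.sub (hWc.comp (continuous_sub_right h))).div_const h
      · refine backward_difference_max_le hh rfl (hpos x t) (herr0 _ _) fun hzp => ?_
        simp only [herr, if_pos hzp]
        exact le_max_left _ _
    have hIi : IntegrableOn (fun x => ∫ t in Ioc t₁ T, err h (x, t)) Ω := by
      refine Measure.integrableOn_of_bounded (M := max C 0 * (T - t₁)) hΩf ?_ ?_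
      · exact ((herrm h).stronglyMeasurable.integral_prod_right
          (ν := volume.restrict (Ioc t₁ T))).aestronglyMeasurable
      · filter_upwards [ae_restrict_mem hΩ] with x hx
        have := norm_setIntegral_le_of_norm_le_const (μ := volume) (s := Ioc t₁ T)
          (f := fun t => err h (x, t)) (C := max C 0) (by simp) fun t ht' => by
            rw [Real.norm_of_nonneg (herr0 _ _)]
            exact herrC h hh hhh x hx t ⟨ht'.1.le, ht'.2⟩
        simpa [Measure.real, ht] using this
    have hI0 : ∀ x, 0 ≤ ∫ t in Ioc t₁ T, err h (x, t) := fun x =>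
      integral_nonneg fun t => herr0 _ _
    have hpt2 : ∀ x, (Metric.ball x₁ ρ).indicator (fun _ => 3 * ρ ^ 2 / (2 * d) * w) x ≤
        Ω.indicator (fun x => Cψ * ∫ t in Ioc t₁ T, err h (x, t)) x + ψ x * discLap h Z x := by
      intro x
      by_cases hx : x ∈ Ω
      · rw [indicator_of_mem hx]
        have h1 := mul_le_mul_of_nonneg_left (hpt x hx) (hψ0 x)
        have h2 := mul_le_mul_of_nonneg_right (hψC x) (hI0 x)
        have h3 : (Metric.ball x₁ ρ).indicator (fun _ => 3 * ρ ^ 2 / (2 * d) * w) x ≤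
            ψ x * (Metric.ball x₁ ρ).indicator (fun _ => w) x := by
          by_cases hxb : x ∈ Metric.ball x₁ ρ
          · rw [indicator_of_mem hxb, indicator_of_mem hxb]
            exact mul_le_mul_of_nonneg_right (hψρ x hxb) hw0
          · rw [indicator_of_notMem hxb, indicator_of_notMem hxb, mul_zero]
        linarith
      · have hxb : x ∉ Metric.ball x₁ ρ := fun h =>
          hx (hρΩ (Metric.ball_subset_ball (by linarith) h))
        rw [indicator_of_notMem hx, indicator_of_notMem hxb, hψoff x hx]
        simp
    have hmono := integral_mono (μ := volume)
      ((integrable_indicator_iff measurableSet_ball).2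
        (integrableOn_const (measure_ball_lt_top.ne)))
      (((integrable_indicator_iff hΩ).2 (hIi.const_mul Cψ)).add hint) hpt2
    rw [integral_add' ((integrable_indicator_iff hΩ).2 (hIi.const_mul Cψ)) hint,
      integral_indicator hΩ, integral_indicator measurableSet_ball, integral_const_mul,
      integral_const_mul] at hmono
    simp only [integral_const, smul_eq_mul, measureReal_restrict_apply_univ] at hmono
    linarith
  set μ := (volume.restrict Ω).prod (volume.restrict (Ioc t₁ T)) with hμ
  have : IsFiniteMeasure (volume.restrict Ω) := ⟨by simpa using hΩf.lt_top⟩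
  have hmem : ∀ᵐ p ∂μ, p.1 ∈ Ω ∧ p.2 ∈ Ioc t₁ T := by
    rw [hμ, Measure.prod_restrict]
    exact (ae_restrict_mem (hΩ.prod measurableSet_Ioc)).mono fun p hp => hp
  set hn : ℕ → ℝ := fun n => 1 / ((n : ℝ) + 1) with hhn
  have hn0 : ∀ n, 0 < hn n := fun n => by simp only [hhn]; positivity
  have hnlim : Tendsto hn atTop (𝓝 0) := tendsto_one_div_add_atTop_nhds_zero_nat
  have hnlim' : Tendsto hn atTop (𝓝[>] 0) :=
    tendsto_nhdsWithin_iff.2 ⟨hnlim, Eventually.of_forall hn0⟩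
  have hnsmall : ∀ᶠ n in atTop, hn n ≤ h₀ ∧ hn n ≤ 1 :=
    (hnlim.eventually (Iic_mem_nhds hh₀)).and (hnlim.eventually (Iic_mem_nhds one_pos))
  have hlim : Tendsto (fun n => ∫ p, err (hn n) p ∂μ) atTop (𝓝 (∫ _p, (0 : ℝ) ∂μ)) := by
    refine tendsto_integral_filter_of_dominated_convergence (fun _ => max C 0) ?_ ?_ ?_ ?_
    · exact Eventually.of_forall fun n => (herrm _).aestronglyMeasurable
    · filter_upwards [hnsmall] with n hns
      filter_upwards [hmem] with p hp
      rw [Real.norm_of_nonneg (herr0 _ _)]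
      exact herrC _ (hn0 n) hns.1 p.1 hp.1 p.2 ⟨hp.2.1.le, hp.2.2⟩
    · exact integrable_const _
    · filter_upwards [hmem] with p hp
      by_cases hzp : 0 < z p.1 p.2
      · refine tendsto_order.2 ⟨fun a ha => Eventually.of_forall fun n =>
          lt_of_lt_of_le ha (herr0 _ _), fun a ha => ?_⟩
        have := hnlim'.eventually
          (hineq p.1 hp.1 p.2 ⟨hp.2.1.le, hp.2.2⟩ hzp (a / 2) (by positivity))
        filter_upwards [this] with n hns
        simp only [herr, if_pos hzp]
        exact max_lt (by linarith) ha
      · simp only [herr, if_neg hzp]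
        exact tendsto_const_nhds
  rw [integral_zero] at hlim
  have hle : ∀ᶠ n in atTop, 3 * ρ ^ 2 / (2 * d) * w * volume.real (Metric.ball x₁ ρ) ≤
      (Cψ * ∫ p, err (hn n) p ∂μ) + e * (T - t₁) * volume.real Ω := by
    filter_upwards [hnsmall] with n hns
    have hi : Integrable (err (hn n)) μ := by
      refine Integrable.of_bound (herrm _).aestronglyMeasurable (max C 0) ?_
      filter_upwards [hmem] with p hp
      rw [Real.norm_of_nonneg (herr0 _ _)]
      exact herrC _ (hn0 n) hns.1 p.1 hp.1 p.2 ⟨hp.2.1.le, hp.2.2⟩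
    rw [integral_prod _ hi]
    exact hstep _ (hn0 n) hns.1 hns.2
  have := ge_of_tendsto ((hlim.const_mul Cψ).add_const (e * (T - t₁) * volume.real Ω)) hle
  simpa using this

end WeightedEstimate

/-! ### A global inverse of the nonlinearity -/

theorem exists_uniform_left_inverse {G : ℝ → ℝ} (hG : ContDiff ℝ 1 G)
    (hG' : ∀ s, 0 < deriv G s) {M : ℝ} (hM : 0 ≤ M) :
    ∃ φ φ' : ℝ → ℝ, (∀ r, HasDerivAt φ (φ' r) r) ∧ UniformContinuous φ' ∧
      (∃ m, 0 < m ∧ ∀ r, m ≤ φ' r) ∧ (∃ L, ∀ r, φ' r ≤ L) ∧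
      ∀ s ∈ Icc (-M) M, φ (G s) = s := by
  have hMM : -M ≤ M := by linarith
  have hGc : Continuous (deriv G) := hG.continuous_deriv le_rfl
  have hGd : ∀ s, HasDerivAt G (deriv G s) s := fun s =>
    (hG.differentiable one_ne_zero s).hasDerivAt
  set c : ℝ → ℝ := fun s => (projIcc (-M) M hMM s : ℝ) with hc
  have hcc : Continuous c := continuous_subtype_val.comp continuous_projIcc
  have hcM : ∀ s, c s ∈ Icc (-M) M := fun s => (projIcc (-M) M hMM s).2
  obtain ⟨a, -, ha⟩ := isCompact_Icc.exists_isMinOn (nonempty_Icc.2 hMM) hGc.continuousOn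
  obtain ⟨b, -, hb⟩ := isCompact_Icc.exists_isMaxOn (nonempty_Icc.2 hMM) hGc.continuousOn
  set g : ℝ → ℝ := fun s => deriv G (c s) with hg
  have hgc : Continuous g := hGc.comp hcc
  have hga : ∀ s, deriv G a ≤ g s := fun s => ha (hcM s)
  have hgb : ∀ s, g s ≤ deriv G b := fun s => hb (hcM s)
  have hgpos : ∀ s, 0 < g s := fun s => hG' _
  set H : ℝ → ℝ := fun s => G 0 + ∫ σ in (0 : ℝ)..s, g σ with hH
  have hHd : ∀ s, HasDerivAt H (g s) s := fun s =>
    (intervalIntegral.integral_hasDerivAt_right (hgc.intervalIntegrable _ _)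
      (hgc.stronglyMeasurableAtFilter _ _) hgc.continuousAt).const_add _
  have hHm : StrictMono H := strictMono_of_deriv_pos fun s => by rw [(hHd s).deriv]; exact hgpos s
  have hHc : Continuous H := continuous_iff_continuousAt.2 fun s => (hHd s).continuousAt
  have hmono : Monotone fun s => H s - deriv G a * s := by
    refine monotone_of_deriv_nonneg (fun s => ?_) fun s => ?_
    · exact ((hHd s).sub ((hasDerivAt_id s).const_mul _)).differentiableAt
    · have h1 : HasDerivAt (fun s => H s - deriv G a * s) (g s - deriv G a * 1) s :=
        (hHd s).sub ((hasDerivAt_id s).const_mul _)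
      rw [h1.deriv]
      simpa using hga s
  have hHs : Function.Surjective H := by
    refine hHc.surjective ?_ ?_
    · refine tendsto_atTop_mono' atTop (f₁ := fun s => deriv G a * s + H 0) ?_
        (tendsto_atTop_add_const_right _ _ (tendsto_id.const_mul_atTop (hG' a)))
      filter_upwards [eventually_ge_atTop 0] with s hs
      have := hmono hs
      simp only [mul_zero, sub_zero] at this
      linarith
    · refine tendsto_atBot_mono' atBot (f₂ := H) (f₁ := fun s => deriv G a * s + H 0) ?_
        (tendsto_atBot_add_const_right _ _ (tendsto_id.const_mul_atBot (hG' a)))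
      filter_upwards [eventually_le_atBot 0] with s hs
      have := hmono hs
      simp only [mul_zero, sub_zero] at this
      linarith
  set ψ := hHm.orderIsoOfSurjective H hHs with hψ
  have hψH : ∀ s, ψ.symm (H s) = s := fun s => ψ.symm_apply_apply s
  have hHψ : ∀ r, H (ψ.symm r) = r := fun r => ψ.apply_symm_apply r
  have hφd : ∀ r, HasDerivAt ψ.symm (g (ψ.symm r))⁻¹ r := fun r =>
    (hHd (ψ.symm r)).of_local_left_inverse ψ.symm.continuous.continuousAt (hgpos _).ne'
      (Eventually.of_forall hHψ)
  have hL : ∀ r, (g (ψ.symm r))⁻¹ ≤ (deriv G a)⁻¹ := fun r => inv_anti₀ (hG' a) (hga _)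
  have hlip : LipschitzWith (Real.toNNReal (deriv G a)⁻¹) ψ.symm := by
    refine lipschitzWith_of_nnnorm_deriv_le (fun r => (hφd r).differentiableAt) fun r => ?_
    rw [(hφd r).deriv, ← NNReal.coe_le_coe, coe_nnnorm,
      Real.norm_of_nonneg (inv_nonneg.2 (hgpos _).le),
      Real.coe_toNNReal _ (inv_nonneg.2 (hG' a).le)]
    exact hL r
  refine ⟨ψ.symm, fun r => (g (ψ.symm r))⁻¹, hφd, ?_, ⟨(deriv G b)⁻¹, inv_pos.2 (hG' b),
    fun r => inv_anti₀ (hgpos _) (hgb _)⟩, ⟨_, hL⟩, fun s hs => ?_⟩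
  · have h1 : UniformContinuous fun s : Icc (-M) M => (deriv G s)⁻¹ :=
      CompactSpace.uniformContinuous_of_continuous
        ((hGc.comp continuous_subtype_val).inv₀ fun s => (hG' _).ne')
    exact h1.comp ((LipschitzWith.projIcc hMM).uniformContinuous.comp hlip.uniformContinuous)
  · have h1 : G s = H s := by
      have h2 : ∫ σ in (0 : ℝ)..s, g σ = ∫ σ in (0 : ℝ)..s, deriv G σ := by
        refine intervalIntegral.integral_congr fun σ hσ => ?_
        have h3 : σ ∈ Icc (-M) M :=
          (ordConnected_Icc.uIcc_subset ⟨by linarith, hM⟩ hs) hσ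
        simp only [hg, hc, projIcc_of_mem hMM h3]
      simp only [hH, h2]
      rw [intervalIntegral.integral_deriv_eq_sub
        (fun σ _ => (hGd σ).differentiableAt) (hGc.intervalIntegrable _ _)]
      ring
    rw [h1, hψH]

/-! ### Sup-convolution -/

section SupConv

variable {d : ℕ}

/-- The cost of moving from `(x, t)` to `p`; it vanishes in time on a window around `t` that
shrinks to a point as `t` increases to `T`. -/
noncomputable def convCost (θ T : ℝ) (x : EuclideanSpace ℝ (Fin d)) (t : ℝ)
    (p : EuclideanSpace ℝ (Fin d) × ℝ) : ℝ :=
  ‖x - p.1‖ ^ 2 + (max ((1 + θ) * t - p.2 - θ * T) 0 ^ 2 + max (p.2 - (1 - θ) * t - θ * T) 0 ^ 2)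

/-- Sup-convolution of `f` over `K`. -/
noncomputable def supConv (K : Set (EuclideanSpace ℝ (Fin d) × ℝ))
    (f : EuclideanSpace ℝ (Fin d) × ℝ → ℝ) (θ T δ : ℝ) (x : EuclideanSpace ℝ (Fin d)) (t : ℝ) : ℝ :=
  sSup ((fun p => f p - convCost θ T x t p / (2 * δ)) '' K)

variable {K : Set (EuclideanSpace ℝ (Fin d) × ℝ)} {f : EuclideanSpace ℝ (Fin d) × ℝ → ℝ}
  {θ T δ : ℝ}

theorem convCost_nonneg (x : EuclideanSpace ℝ (Fin d)) (t : ℝ)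
    (p : EuclideanSpace ℝ (Fin d) × ℝ) : 0 ≤ convCost θ T x t p := by
  unfold convCost; positivity

theorem continuous_supConv (hK : IsCompact K) (hf : ContinuousOn f K) :
    Continuous (Function.uncurry (supConv K f θ T δ)) := by
  have : CompactSpace K := isCompact_iff_compactSpace.1 hK
  have h1 : Continuous fun q : EuclideanSpace ℝ (Fin d) × ℝ => sSup ((fun p : K =>
      K.domRestrict f p - convCost θ T q.1 q.2 p / (2 * δ)) '' univ) := by
    refine isCompact_univ.continuous_sSup ?_
    have h2 : Continuous fun r : (EuclideanSpace ℝ (Fin d) × ℝ) × K => K.domRestrict f r.2 :=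
      (continuousOn_iff_continuous_domRestrict.1 hf).comp continuous_snd
    have h3 : Continuous fun r : (EuclideanSpace ℝ (Fin d) × ℝ) × K =>
        convCost θ T r.1.1 r.1.2 r.2 := by
      unfold convCost; fun_prop
    exact h2.sub (h3.div_const _)
  convert h1 using 2 with q
  simp only [Function.uncurry, supConv]
  congr 1
  ext y
  simp [Set.domRestrict_apply]

theorem le_supConv (hK : IsCompact K) (hf : ContinuousOn f K) (x : EuclideanSpace ℝ (Fin d)) (t : ℝ)
    {p : EuclideanSpace ℝ (Fin d) × ℝ} (hp : p ∈ K) :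
    f p - convCost θ T x t p / (2 * δ) ≤ supConv K f θ T δ x t := by
  refine le_csSup ?_ (mem_image_of_mem _ hp)
  refine (hK.image_of_continuousOn ?_).bddAbove
  refine hf.sub (Continuous.continuousOn ?_)
  unfold convCost; fun_prop

theorem exists_supConv_eq (hK : IsCompact K) (hK0 : K.Nonempty) (hf : ContinuousOn f K)
    (x : EuclideanSpace ℝ (Fin d)) (t : ℝ) :
    ∃ p ∈ K, supConv K f θ T δ x t = f p - convCost θ T x t p / (2 * δ) := by
  refine hK.exists_sSup_image_eq hK0 (hf.sub (Continuous.continuousOn ?_))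
  unfold convCost; fun_prop

theorem discLap_le_of_le {h : ℝ} {g₁ g₂ : EuclideanSpace ℝ (Fin d) → ℝ}
    {x y : EuclideanSpace ℝ (Fin d)} {c : ℝ} (hxy : g₂ x = g₁ y - c)
    (h1 : ∀ i, g₁ (y + h • EuclideanSpace.single i 1) - c ≤ g₂ (x + h • EuclideanSpace.single i 1))
    (h2 : ∀ i, g₁ (y - h • EuclideanSpace.single i 1) - c ≤
      g₂ (x - h • EuclideanSpace.single i 1)) :
    discLap h g₁ y ≤ discLap h g₂ x := by
  refine Finset.sum_le_sum fun i _ => div_le_div_of_nonneg_right ?_ (sq_nonneg h)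
  linarith [h1 i, h2 i]

theorem neg_le_discLap_supConv (hK : IsCompact K) (hK0 : K.Nonempty) (hf : ContinuousOn f K)
    (hδ : 0 < δ) {h : ℝ} (hh : 0 < h) (x : EuclideanSpace ℝ (Fin d)) (t : ℝ) :
    -(d / δ) ≤ discLap h (fun y => supConv K f θ T δ y t) x := by
  obtain ⟨p, hp, hpe⟩ := exists_supConv_eq (θ := θ) (T := T) (δ := δ) hK hK0 hf x t
  have h1 : ∑ _i : Fin d, (-(1 / δ)) ≤ discLap h (fun y => supConv K f θ T δ y t) x := by
    refine Finset.sum_le_sum fun i _ => ?_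
    set e : EuclideanSpace ℝ (Fin d) := EuclideanSpace.single i 1 with he
    have he1 : ‖e‖ = 1 := by simp [he]
    have h2 := le_supConv (θ := θ) (T := T) (δ := δ) hK hf (x + h • e) t hp
    have h3 := le_supConv (θ := θ) (T := T) (δ := δ) hK hf (x - h • e) t hp
    have h4 : convCost θ T (x + h • e) t p + convCost θ T (x - h • e) t p
        - 2 * convCost θ T x t p = 2 * h ^ 2 := by
      have h5 : x + h • e - p.1 = (x - p.1) + h • e := by abel
      have h6 : x - h • e - p.1 = (x - p.1) - h • e := by abel
      have h7 := parallelogram_law_with_norm ℝ (x - p.1) (h • e)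
      have h8 : ‖h • e‖ = h := by rw [norm_smul, he1, mul_one, Real.norm_of_nonneg hh.le]
      unfold convCost
      rw [h5, h6]
      rw [h8] at h7
      linarith
    rw [le_div_iff₀ (by positivity)]
    have h9 : convCost θ T (x + h • e) t p / (2 * δ) + convCost θ T (x - h • e) t p / (2 * δ)
        - 2 * (convCost θ T x t p / (2 * δ)) = 1 / δ * h ^ 2 := by
      rw [show convCost θ T (x + h • e) t p / (2 * δ) + convCost θ T (x - h • e) t p / (2 * δ)
        - 2 * (convCost θ T x t p / (2 * δ)) = (convCost θ T (x + h • e) t p +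
        convCost θ T (x - h • e) t p - 2 * convCost θ T x t p) / (2 * δ) by ring, h4]
      field_simp
    linarith
  refine le_trans (le_of_eq ?_) h1
  simp [div_eq_mul_inv]

theorem max_zero_sq_sub_le (a b : ℝ) : max a 0 ^ 2 - max b 0 ^ 2 ≤ 2 * max a 0 * (a - b) := by
  rcases le_total a 0 with ha | ha <;> rcases le_total b 0 with hb | hb <;> simp [ha, hb] <;>
    nlinarith [sq_nonneg (a - b)]

theorem supConv_sub_le (hK : IsCompact K) (hK0 : K.Nonempty) (hf : ContinuousOn f K)
    (hδ : 0 < δ) (hθ : 0 ≤ θ) (hθ1 : θ ≤ 1) (hT : 0 ≤ T) {S : ℝ} (hS : 0 ≤ S)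
    (hKS : ∀ p ∈ K, p.2 ≤ S)
    (x : EuclideanSpace ℝ (Fin d)) {t t' : ℝ} (ht' : 0 ≤ t') (htt : t' ≤ t) :
    supConv K f θ T δ x t - supConv K f θ T δ x t' ≤ S / δ * (t - t') := by
  obtain ⟨p, hp, hpe⟩ := exists_supConv_eq (θ := θ) (T := T) (δ := δ) hK hK0 hf x t
  have h2 := le_supConv (θ := θ) (T := T) (δ := δ) hK hf x t' hp
  have h3 : convCost θ T x t' p - convCost θ T x t p ≤ 2 * S * (t - t') := by
    have h4 := max_zero_sq_sub_le ((1 + θ) * t' - p.2 - θ * T) ((1 + θ) * t - p.2 - θ * T)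
    have h5 := max_zero_sq_sub_le (p.2 - (1 - θ) * t' - θ * T) (p.2 - (1 - θ) * t - θ * T)
    have h6 : max (p.2 - (1 - θ) * t' - θ * T) 0 ≤ S := by
      refine max_le ?_ hS
      have := mul_nonneg (sub_nonneg.2 hθ1) ht'
      have := mul_nonneg hθ hT
      linarith [hKS p hp]
    have h7 : 0 ≤ max ((1 + θ) * t' - p.2 - θ * T) 0 := le_max_right _ _
    have h8 : 0 ≤ max (p.2 - (1 - θ) * t' - θ * T) 0 := le_max_right _ _
    unfold convCost
    nlinarith [mul_nonneg h7 (mul_nonneg (by linarith : 0 ≤ 1 + θ) (sub_nonneg.2 htt)),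
      mul_nonneg (sub_nonneg.2 h6) (sub_nonneg.2 htt),
      mul_nonneg h8 (mul_nonneg hθ (sub_nonneg.2 htt))]
  have h4 : (convCost θ T x t' p - convCost θ T x t p) / (2 * δ) ≤ S / δ * (t - t') := by
    rw [div_le_iff₀ (by positivity)]
    refine h3.trans (le_of_eq ?_)
    field_simp
  rw [sub_div] at h4
  linarith

end SupConv

/-! ### Differential inequality for the sup-convolution of a subsolution -/

section SupConvSub

variable {d : ℕ} {Ω : Set (EuclideanSpace ℝ (Fin d))} {G : ℝ → ℝ}
  {v : EuclideanSpace ℝ (Fin d) → ℝ → ℝ} {θ T δ : ℝ}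

theorem hasDerivAt_convCost_fst (x : EuclideanSpace ℝ (Fin d)) (t : ℝ)
    (p : EuclideanSpace ℝ (Fin d) × ℝ) :
    HasDerivAt (fun τ => convCost θ T x τ p)
      (2 * ((1 + θ) * max ((1 + θ) * t - p.2 - θ * T) 0 -
        (1 - θ) * max (p.2 - (1 - θ) * t - θ * T) 0)) t := by
  have h1 : HasDerivAt (fun τ => (1 + θ) * τ - p.2 - θ * T) (1 + θ) t := by
    simpa using (((hasDerivAt_id t).const_mul (1 + θ)).sub_const p.2).sub_const (θ * T)
  have h2 : HasDerivAt (fun τ => p.2 - (1 - θ) * τ - θ * T) (-(1 - θ)) t := by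
    simpa using (((hasDerivAt_id t).const_mul (1 - θ)).const_sub p.2).sub_const (θ * T)
  have h3 := (hasDerivAt_max_zero_pow 0 ((1 + θ) * t - p.2 - θ * T)).comp t h1
  have h4 := (hasDerivAt_max_zero_pow 0 (p.2 - (1 - θ) * t - θ * T)).comp t h2
  refine ((h3.add h4).const_add (‖x - p.1‖ ^ 2)).congr_deriv ?_
  push_cast
  ring

theorem hasDerivAt_convCost_snd (x y : EuclideanSpace ℝ (Fin d)) (t s : ℝ) :
    HasDerivAt (fun τ => convCost θ T x t (y, τ))
      (2 * (max (s - (1 - θ) * t - θ * T) 0 - max ((1 + θ) * t - s - θ * T) 0)) s := by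
  have h1 : HasDerivAt (fun τ => (1 + θ) * t - τ - θ * T) (-1) s := by
    simpa using ((hasDerivAt_id s).const_sub ((1 + θ) * t)).sub_const (θ * T)
  have h2 : HasDerivAt (fun τ => τ - (1 - θ) * t - θ * T) 1 s := by
    simpa using ((hasDerivAt_id s).sub_const ((1 - θ) * t)).sub_const (θ * T)
  have h3 := (hasDerivAt_max_zero_pow 0 ((1 + θ) * t - s - θ * T)).comp s h1
  have h4 := (hasDerivAt_max_zero_pow 0 (s - (1 - θ) * t - θ * T)).comp s h2
  refine ((h3.add h4).const_add (‖x - y‖ ^ 2)).congr_deriv ?_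
  push_cast
  ring

theorem IsSub.supConv_ineq (hΩ : IsOpen Ω) (hG : Differentiable ℝ G) (hv : IsSub Ω G v) {S : ℝ}
    (hK : IsCompact (closure Ω ×ˢ Icc 0 S))
    (hf : ContinuousOn (fun p : EuclideanSpace ℝ (Fin d) × ℝ => G (v p.1 p.2))
      (closure Ω ×ˢ Icc 0 S))
    {φ φ' : ℝ → ℝ} (hφ : ∀ r, HasDerivAt φ (φ' r) r) (hφ' : ∀ r, 0 < φ' r)
    (hφv : ∀ p ∈ closure Ω ×ˢ Icc 0 S, φ (G (v p.1 p.2)) = v p.1 p.2)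
    (hδ : 0 < δ) {x y : EuclideanSpace ℝ (Fin d)} {t s : ℝ}
    (hy : y ∈ Ω) (hs : 0 < s) (hsS : s < S)
    (hQ : supConv (closure Ω ×ˢ Icc 0 S) (fun p => G (v p.1 p.2)) θ T δ x t =
      G (v y s) - convCost θ T x t (y, s) / (2 * δ))
    (hreg : ∀ e, DifferentiableAt ℝ (fun z => fderiv ℝ (fun z => G (v z s)) z e) y)
    (hclose : |φ' (supConv (closure Ω ×ˢ Icc 0 S) (fun p => G (v p.1 p.2)) θ T δ x t) -
      φ' (G (v y s))| ≤
      θ * φ' (supConv (closure Ω ×ˢ Icc 0 S) (fun p => G (v p.1 p.2)) θ T δ x t))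
    {ε : ℝ} (hε : 0 < ε) :
    ∀ᶠ h in 𝓝[>] (0 : ℝ),
      (φ (supConv (closure Ω ×ˢ Icc 0 S) (fun p => G (v p.1 p.2)) θ T δ x t) -
        φ (supConv (closure Ω ×ˢ Icc 0 S) (fun p => G (v p.1 p.2)) θ T δ x (t - h))) / h -
      discLap h (fun z => supConv (closure Ω ×ˢ Icc 0 S) (fun p => G (v p.1 p.2)) θ T δ z t) x
        ≤ ε := by
  set Q := supConv (closure Ω ×ˢ Icc 0 S) (fun p => G (v p.1 p.2)) θ T δ with hQdef
  have hle : ∀ x t y s, y ∈ closure Ω → s ∈ Icc 0 S →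
      G (v y s) - convCost θ T x t (y, s) / (2 * δ) ≤ Q x t := fun x t y s hy hs =>
    le_supConv hK hf x t (p := (y, s)) ⟨hy, hs⟩
  have hmono : Monotone φ := (strictMono_of_deriv_pos fun r => by
    rw [(hφ r).deriv]; exact hφ' r).monotone
  set α := max ((1 + θ) * t - s - θ * T) 0 with hα
  set γ := max (s - (1 - θ) * t - θ * T) 0 with hγ
  have hα0 : 0 ≤ α := le_max_right _ _
  have hγ0 : 0 ≤ γ := le_max_right _ _
  have hnear : ∀ᶠ τ in 𝓝 s, τ ∈ Icc 0 S := Icc_mem_nhds hs hsS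
  have hvt := (hv.time y hy s hs).hasDerivAt
  have hft : HasDerivAt (fun τ => G (v y τ)) (deriv G (v y s) * deriv (v y) s) s :=
    (hG (v y s)).hasDerivAt.comp s hvt
  have hcrit : deriv G (v y s) * deriv (v y) s = (γ - α) / δ := by
    have h1 : IsLocalMax (fun τ => G (v y τ) - convCost θ T x t (y, τ) / (2 * δ)) s := by
      filter_upwards [hnear] with τ hτ
      rw [← hQ]
      exact hle x t y τ (subset_closure hy) hτ
    have h2 := h1.hasDerivAt_eq_zero
      (hft.sub ((hasDerivAt_convCost_snd x y t s).div_const (2 * δ)))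
    rw [mul_div_mul_left _ _ two_ne_zero] at h2
    exact sub_eq_zero.1 h2
  have hvs : deriv (v y) s = φ' (G (v y s)) * ((γ - α) / δ) := by
    have h1 := (hφ (G (v y s))).comp s hft
    rw [hcrit] at h1
    refine hvt.unique (h1.congr_of_eventuallyEq ?_)
    filter_upwards [hnear] with τ hτ
    exact (hφv (y, τ) ⟨subset_closure hy, hτ⟩).symm
  have hlap : Tendsto (fun h => discLap h (fun z => G (v z s)) y) (𝓝[>] 0)
      (𝓝 (laplacian (fun z => G (v z s)) y)) :=
    tendsto_discLap (eventually_differentiableAt_comp hG (hv.space s hs y hy)) hreg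
  have hlap2 : φ' (G (v y s)) * ((γ - α) / δ) ≤ laplacian (fun z => G (v z s)) y :=
    hvs ▸ hv.ineq y hy s hs
  have htime : Tendsto (fun h => (φ (Q x t) -
      φ (G (v y s) - convCost θ T x (t - h) (y, s) / (2 * δ))) / h) (𝓝[>] 0)
      (𝓝 (φ' (Q x t) * (((1 - θ) * γ - (1 + θ) * α) / δ))) := by
    have h1 : HasDerivAt (fun h => t - h) (-1) (0 : ℝ) := by
      simpa using (hasDerivAt_id (0 : ℝ)).const_sub t
    have h2 := hasDerivAt_convCost_fst (θ := θ) (T := T) x t (y, s)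
    rw [← sub_zero t] at h2
    have h3 := ((h2.comp (0 : ℝ) h1).div_const (2 * δ)).const_sub (G (v y s))
    have h4 := hφ (Q x t)
    rw [hQ] at h4
    rw [← sub_zero t] at h4
    have h5 := (h4.comp (0 : ℝ) h3).tendsto_slope.mono_left
      (nhdsWithin_mono 0 (fun x (hx : x ∈ Ioi 0) => ne_of_gt hx))
    have h6 := h5.neg
    simp only [sub_zero] at h6
    rw [← hQ] at h6
    refine (h6.congr' ?_).trans (le_of_eq ?_)
    · filter_upwards with h
      simp only [slope_def_field, Function.comp, sub_zero]
      rw [← hQ]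
      ring
    · congr 1
      rw [← hα, ← hγ]
      field_simp
      ring
  have hnonpos : φ' (Q x t) * (((1 - θ) * γ - (1 + θ) * α) / δ) -
      laplacian (fun z => G (v z s)) y < ε := by
    have h1 : (φ' (Q x t) - φ' (G (v y s))) * ((γ - α) / δ) ≤
        θ * φ' (Q x t) * ((γ + α) / δ) := by
      refine (le_abs_self _).trans ?_
      rw [abs_mul]
      refine mul_le_mul hclose ?_ (abs_nonneg _) ((abs_nonneg _).trans hclose)
      rw [abs_div, abs_of_pos hδ]
      gcongr
      exact abs_le.2 ⟨by linarith, by linarith⟩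
    have h2 : φ' (Q x t) * (((1 - θ) * γ - (1 + θ) * α) / δ) =
        φ' (Q x t) * ((γ - α) / δ) - θ * φ' (Q x t) * ((γ + α) / δ) := by ring
    rw [h2]
    linarith
  have hin : ∀ᶠ h in 𝓝[>] (0 : ℝ), ∀ i : Fin d,
      y + h • EuclideanSpace.single i (1 : ℝ) ∈ Ω ∧
      y - h • EuclideanSpace.single i (1 : ℝ) ∈ Ω := by
    refine eventually_all.2 fun i => ?_
    refine (Eventually.filter_mono nhdsWithin_le_nhds ?_).and
      (Eventually.filter_mono nhdsWithin_le_nhds ?_)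
    · exact (tendsto_line y (EuclideanSpace.single i (1 : ℝ))).eventually (hΩ.eventually_mem hy)
    · have := (tendsto_line y (-EuclideanSpace.single i (1 : ℝ))).eventually (hΩ.eventually_mem hy)
      simpa only [smul_neg, ← sub_eq_add_neg] using this
  filter_upwards [(htime.sub hlap).eventually (gt_mem_nhds hnonpos), hin, self_mem_nhdsWithin]
    with h h1 h2 h3
  have hh : 0 < h := h3
  have h4 : discLap h (fun z => G (v z s)) y ≤ discLap h (fun z => Q z t) x := by
    have hc : ∀ w, convCost θ T (x + w) t (y + w, s) = convCost θ T x t (y, s) := fun w => by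
      simp only [convCost, add_sub_add_right_eq_sub]
    refine discLap_le_of_le hQ (fun i => ?_) fun i => ?_
    · rw [← hc (h • EuclideanSpace.single i 1)]
      exact hle _ _ _ _ (subset_closure (h2 i).1) ⟨hs.le, hsS.le⟩
    · rw [← hc (-(h • EuclideanSpace.single i 1)), ← sub_eq_add_neg, ← sub_eq_add_neg]
      exact hle _ _ _ _ (subset_closure (h2 i).2) ⟨hs.le, hsS.le⟩
  have h5 : (φ (Q x t) - φ (Q x (t - h))) / h ≤
      (φ (Q x t) - φ (G (v y s) - convCost θ T x (t - h) (y, s) / (2 * δ))) / h := by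
    gcongr
    exact hmono (hle _ _ _ _ (subset_closure hy) ⟨hs.le, hsS.le⟩)
  linarith

end SupConvSub

section Package

variable {d : ℕ} {Ω : Set (EuclideanSpace ℝ (Fin d))} {G : ℝ → ℝ}
  {v : EuclideanSpace ℝ (Fin d) → ℝ → ℝ} {T : ℝ}

/-- Near-maximizers of the sup-convolution are close to the base point. -/
theorem supConv_localization {K : Set (EuclideanSpace ℝ (Fin d) × ℝ)}
    {f : EuclideanSpace ℝ (Fin d) × ℝ → ℝ} {θ T δ M r : ℝ} (hδ : 0 < δ) (hr : 0 ≤ r)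
    (hθ : 0 ≤ θ) (hδr : 4 * M * δ < r ^ 2) {x : EuclideanSpace ℝ (Fin d)} {t : ℝ}
    (hTt : t ≤ T) {p : EuclideanSpace ℝ (Fin d) × ℝ}
    (hfp : f p ≤ M) (hQ : supConv K f θ T δ x t = f p - convCost θ T x t p / (2 * δ))
    (hM : -M ≤ supConv K f θ T δ x t) :
    ‖x - p.1‖ < r ∧ ∃ s, |s - p.2| < r ∧ |s - t| ≤ θ * (T - t) ∧ convCost θ T x t (x, s) = 0 ∧
      min t p.2 ≤ s ∧ s ≤ max t p.2 := by
  have h1 : convCost θ T x t p < r ^ 2 := by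
    have : convCost θ T x t p / (2 * δ) ≤ 2 * M := by linarith
    rw [div_le_iff₀ (by positivity)] at this
    linarith
  unfold convCost at h1
  have hb := mul_nonneg hθ (sub_nonneg.2 hTt)
  have e1 := sq_nonneg ‖x - p.1‖
  have e2 := sq_nonneg (max ((1 + θ) * t - p.2 - θ * T) 0)
  have e3 := sq_nonneg (max (p.2 - (1 - θ) * t - θ * T) 0)
  have h2 : ‖x - p.1‖ < r := lt_of_pow_lt_pow_left₀ 2 hr (by linarith)
  have h3 : max ((1 + θ) * t - p.2 - θ * T) 0 < r := lt_of_pow_lt_pow_left₀ 2 hr (by linarith)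
  have h4 : max (p.2 - (1 - θ) * t - θ * T) 0 < r := lt_of_pow_lt_pow_left₀ 2 hr (by linarith)
  have h3' := (le_max_left _ _).trans_lt h3
  have h4' := (le_max_left _ _).trans_lt h4
  have hrpos := (le_max_right _ _).trans_lt h3
  refine ⟨h2, max (t - θ * (T - t)) (min p.2 (t + θ * (T - t))), ?_, ?_, ?_, ?_⟩
  · rcases le_total p.2 (t + θ * (T - t)) with h | h <;>
      rcases le_total (t - θ * (T - t)) p.2 with h' | h' <;>
      simp only [abs_lt, min_eq_left, min_eq_right, max_eq_left, max_eq_right, h, h',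
        max_eq_right (by linarith : t - θ * (T - t) ≤ t + θ * (T - t))] <;>
      constructor <;> linarith
  · rw [abs_le]
    have := min_le_right p.2 (t + θ * (T - t))
    constructor
    · linarith [le_max_left (t - θ * (T - t)) (min p.2 (t + θ * (T - t)))]
    · have : max (t - θ * (T - t)) (min p.2 (t + θ * (T - t))) ≤ t + θ * (T - t) :=
        max_le (by linarith) this
      linarith
  · have h5 := le_max_left (t - θ * (T - t)) (min p.2 (t + θ * (T - t)))
    have h6 : max (t - θ * (T - t)) (min p.2 (t + θ * (T - t))) ≤ t + θ * (T - t) :=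
      max_le (by linarith) (min_le_right _ _)
    set s := max (t - θ * (T - t)) (min p.2 (t + θ * (T - t)))
    unfold convCost
    rw [max_eq_right (by simp only; linarith), max_eq_right (by simp only; linarith)]
    simp
  · constructor
    · refine le_max_of_le_right (le_min (min_le_right _ _) ((min_le_left _ _).trans (by linarith)))
    · exact max_le ((by linarith : t - θ * (T - t) ≤ t).trans (le_max_left _ _))
        ((min_le_left _ _).trans (le_max_right _ _))

theorem IsSub.exists_supConv (hΩ : IsOpen Ω) (hΩb : Bornology.IsBounded Ω)
    (hΩ0 : Ω.Nonempty) (hG : Differentiable ℝ G) (hv : IsSub Ω G v) (hT : 0 ≤ T)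
    {φ φ' : ℝ → ℝ} (hφ : ∀ r, HasDerivAt φ (φ' r) r) (hφ'u : UniformContinuous φ')
    {m L : ℝ} (hm : 0 < m) (hφ'm : ∀ r, m ≤ φ' r) (hφ'L : ∀ r, φ' r ≤ L)
    (hφv : ∀ p ∈ closure Ω ×ˢ Icc 0 (T + 1), φ (G (v p.1 p.2)) = v p.1 p.2)
    {r : ℝ} (hr : 0 < r) (hr1 : r ≤ 1) :
    ∃ Q : EuclideanSpace ℝ (Fin d) → ℝ → ℝ, Continuous (Function.uncurry Q) ∧
      (∀ x ∈ closure Ω, ∀ t ∈ Icc 0 T, G (v x t) ≤ Q x t) ∧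
      (∃ C, ∀ x t, Q x t ≤ C) ∧
      (∃ C, ∀ x, ∀ t ∈ Icc 0 T, ∀ h, 0 < h → h ≤ t →
        (φ (Q x t) - φ (Q x (t - h))) / h - discLap h (fun z => Q z t) x ≤ C) ∧
      ∀ x ∈ closure Ω, ∀ t ∈ Icc 0 T, ∃ y ∈ closure Ω, ∃ s ∈ Icc 0 (T + 1),
        dist x y < r ∧ |s - t| < r ∧ Q x t ≤ G (v y s) ∧
        (y ∈ Ω → 0 < s →
          (∀ e, DifferentiableAt ℝ (fun z => fderiv ℝ (fun z => G (v z s)) z e) y) →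
          ∀ ε > 0, ∀ᶠ h in 𝓝[>] (0 : ℝ),
            (φ (Q x t) - φ (Q x (t - h))) / h - discLap h (fun z => Q z t) x ≤ ε) := by
  set K : Set (EuclideanSpace ℝ (Fin d) × ℝ) := closure Ω ×ˢ Icc 0 (T + 1) with hKdef
  have hK : IsCompact K := hΩb.isCompact_closure.prod isCompact_Icc
  have hK0 : K.Nonempty := hΩ0.closure.prod ⟨0, by simp; linarith⟩
  set f : EuclideanSpace ℝ (Fin d) × ℝ → ℝ := fun p => G (v p.1 p.2) with hfdef
  have hf : ContinuousOn f K := hG.continuous.comp_continuousOn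
    (hv.cont.mono (prod_mono le_rfl fun t ht => ht.1))
  obtain ⟨M, hM⟩ := hK.exists_bound_of_continuousOn hf
  have hM0 : 0 ≤ M := by
    obtain ⟨p, hp⟩ := hK0
    exact (norm_nonneg _).trans (hM p hp)
  set θ := r / (2 * (T + 1)) with hθdef
  have hθ : 0 < θ := by positivity
  have hθ1 : θ ≤ 1 := by rw [hθdef, div_le_one (by positivity)]; linarith
  have hθT : θ * (T + 1) = r / 2 := by rw [hθdef]; field_simp
  obtain ⟨κ, hκ, hφκ⟩ := Metric.uniformContinuous_iff.1 hφ'u (θ * m) (by positivity)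
  obtain ⟨r₂, hr₂, hfr₂⟩ := Metric.uniformContinuousOn_iff.1
    (hK.uniformContinuousOn_of_continuous hf) κ hκ
  set r₃ := min r₂ (r / 2) with hr₃def
  have hr₃ : 0 < r₃ := lt_min hr₂ (by positivity)
  set δ := r₃ ^ 2 / (4 * (M + 1)) with hδdef
  have hδ : 0 < δ := by positivity
  have hδr : 4 * M * δ < r₃ ^ 2 := by
    have : 4 * (M + 1) * δ = r₃ ^ 2 := by rw [hδdef]; field_simp
    linarith
  set Q := supConv K f θ T δ with hQdef
  have hQf : ∀ x ∈ closure Ω, ∀ t ∈ Icc 0 T, f (x, t) ≤ Q x t := by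
    intro x hx t ht
    have h1 := le_supConv (θ := θ) (T := T) (δ := δ) hK hf x t (p := (x, t))
      ⟨hx, ht.1, by linarith [ht.2]⟩
    have h2 : convCost θ T x t (x, t) = 0 := by
      have := mul_nonneg hθ.le (sub_nonneg.2 ht.2)
      unfold convCost
      rw [max_eq_right (by simp only; linarith), max_eq_right (by simp only; linarith)]
      simp
    rwa [h2, zero_div, sub_zero] at h1
  have hQC : ∀ x t, ∃ p ∈ K, Q x t = f p - convCost θ T x t p / (2 * δ) := fun x t =>
    exists_supConv_eq hK hK0 hf x t
  have hcost : ∀ (x : EuclideanSpace ℝ (Fin d)) t p, 0 ≤ convCost θ T x t p / (2 * δ) := fun x t p =>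
    div_nonneg (convCost_nonneg x t p) (by positivity)
  have hφp : ∀ r, 0 < φ' r := fun r => hm.trans_le (hφ'm r)
  have hmono : Monotone φ := (strictMono_of_deriv_pos fun r => by
    rw [(hφ r).deriv]; exact hφp r).monotone
  refine ⟨Q, continuous_supConv hK hf, hQf, ⟨M, fun x t => ?_⟩,
    ⟨L * ((T + 1) / δ) + d / δ, fun x t ht h hh hht => ?_⟩, fun x hx t ht => ?_⟩
  · obtain ⟨p, hp, he⟩ := hQC x t
    rw [he]
    linarith [hcost x t p, (abs_le.1 (hM p hp)).2]
  · have h1 := neg_le_discLap_supConv (θ := θ) (T := T) hK hK0 hf hδ hh x t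
    have h2 := supConv_sub_le hK hK0 hf hδ hθ.le hθ1 hT (by linarith : (0 : ℝ) ≤ T + 1)
      (fun p hp => hp.2.2) x (sub_nonneg.2 hht) (by linarith : t - h ≤ t)
    have hL0 : 0 ≤ L := (hφp 0).le.trans (hφ'L 0)
    have h3 : φ (Q x t) - φ (Q x (t - h)) ≤ L * ((T + 1) / δ * h) := by
      rcases le_total (Q x t) (Q x (t - h)) with h4 | h4
      · have : 0 ≤ L * ((T + 1) / δ * h) := by positivity
        linarith [hmono h4]
      · have h5 := Convex.image_sub_le_mul_sub_of_deriv_le (convex_univ)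
          (f := φ) (C := L) (fun r _ => (hφ r).continuousAt.continuousWithinAt)
          (fun r _ => (hφ r).differentiableAt.differentiableWithinAt)
          (fun r _ => by rw [(hφ r).deriv]; exact hφ'L r) _ (mem_univ _) _ (mem_univ _) h4
        refine h5.trans (mul_le_mul_of_nonneg_left ?_ hL0)
        rw [sub_sub_cancel] at h2
        exact h2
    have h6 : (φ (Q x t) - φ (Q x (t - h))) / h ≤ L * ((T + 1) / δ) := by
      rw [div_le_iff₀ hh]; linarith
    linarith
  · obtain ⟨⟨y, s⟩, hp, he⟩ := hQC x t
    have hfx : -M ≤ Q x t := by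
      refine le_trans ?_ (hQf x hx t ht)
      exact (abs_le.1 (hM (x, t) ⟨hx, ht.1, by linarith [ht.2]⟩)).1
    obtain ⟨h1, s', h2, h3, h4, h5, h6⟩ := supConv_localization hδ hr₃.le hθ.le hδr ht.2
      (abs_le.1 (hM _ hp)).2 he hfx
    simp only at h1 h2 h5 h6
    have hs' : s' ∈ Icc 0 (T + 1) :=
      ⟨(le_min ht.1 hp.2.1).trans h5, h6.trans (max_le (by linarith [ht.2]) hp.2.2)⟩
    have hQs := le_supConv (θ := θ) (T := T) (δ := δ) hK hf x t (p := (x, s')) ⟨hx, hs'⟩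
    rw [h4, zero_div, sub_zero] at hQs
    have hst : |s - t| < r := by
      have h7 : |s - t| ≤ |s' - s| + |s' - t| := by
        rw [abs_sub_comm s' s]; exact abs_sub_le _ _ _
      have h8 : θ * (T - t) ≤ r / 2 := by
        rw [← hθT]; gcongr; linarith [ht.1]
      linarith [min_le_right r₂ (r / 2)]
    have hQle : Q x t ≤ f (y, s) := by linarith [hcost x t (y, s)]
    refine ⟨y, hp.1, s, hp.2, ?_, hst, hQle, fun hy hs hreg ε hε => ?_⟩
    · rw [dist_eq_norm]
      linarith [min_le_right r₂ (r / 2)]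
    · have hsS : s < T + 1 := by linarith [(abs_lt.1 hst).2, ht.2]
      refine hv.supConv_ineq hΩ hG hK hf hφ hφp hφv hδ hy hs hsS he hreg ?_ hε
      have h7 : dist (y, s) (x, s') < r₂ := by
        rw [Prod.dist_eq, max_lt_iff, dist_comm y x, dist_eq_norm, dist_comm s s', Real.dist_eq]
        exact ⟨h1.trans_le (min_le_left _ _), h2.trans_le (min_le_left _ _)⟩
      have h8 := hfr₂ (y, s) hp (x, s') ⟨hx, hs'⟩ h7
      have h9 : dist (Q x t) (f (y, s)) < κ := by
        rw [Real.dist_eq] at h8 ⊢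
        rw [abs_lt] at h8 ⊢
        constructor <;> linarith
      have h10 := hφκ h9
      rw [Real.dist_eq] at h10
      exact h10.le.trans (mul_le_mul_of_nonneg_left (hφ'm _) hθ.le)

end Package

/-! ### Comparison in positive dimension -/

section Comparison

variable {d : ℕ} {Ω : Set (EuclideanSpace ℝ (Fin d))} {G : ℝ → ℝ}
  {u v : EuclideanSpace ℝ (Fin d) → ℝ → ℝ}

theorem discLap_add (h : ℝ) (f g : EuclideanSpace ℝ (Fin d) → ℝ) (x : EuclideanSpace ℝ (Fin d)) :
    discLap h (fun y => f y + g y) x = discLap h f x + discLap h g x := by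
  simp only [discLap, ← Finset.sum_add_distrib]
  exact Finset.sum_congr rfl fun i _ => by ring

theorem differentiableAt_fderiv_fun_neg {f : EuclideanSpace ℝ (Fin d) → ℝ}
    {x e : EuclideanSpace ℝ (Fin d)} (h : DifferentiableAt ℝ (fun z => fderiv ℝ f z e) x) :
    DifferentiableAt ℝ (fun z => fderiv ℝ (fun z => -f z) z e) x := by
  simpa only [fderiv_fun_neg, neg_apply] using h.fun_neg

theorem IsSub.differentiableAt_fderiv_of_lt (hΩ : IsOpen Ω) (hG : ContDiff ℝ 1 G)
    (hG' : ∀ s, 0 < deriv G s) (hu : IsSuper Ω G u) (hv : IsSub Ω G v)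
    {x y : EuclideanSpace ℝ (Fin d)} {t s : ℝ} (hx : x ∈ Ω) (hy : y ∈ Ω) (ht : 0 < t) (hs : 0 < s)
    (h0 : v y 0 < u x 0) (h : u x t < v y s) (e : EuclideanSpace ℝ (Fin d)) :
    DifferentiableAt ℝ (fun z => fderiv ℝ (fun z => G (v z s)) z e) y := by
  have h1 := hv.neg.differentiableAt_fderiv_of_lt hΩ hG.oddReflect
    (fun s => by rw [deriv_oddReflect]; exact hG' _) hu.neg hy hx hs ht
    (neg_lt_neg h0) (neg_lt_neg h) e
  simpa only [oddReflect, neg_neg] using differentiableAt_fderiv_fun_neg h1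

theorem exists_frontier_dist_lt {r : ℝ} {x y : EuclideanSpace ℝ (Fin d)} (hx : x ∈ Ω) (hy : y ∉ Ω)
    (h : dist x y < r) : ∃ b ∈ frontier Ω, dist x b < r := by
  obtain ⟨b, hb, hbd⟩ := exists_mem_frontier_infDist_compl_eq_dist hx
    (ne_univ_iff_exists_notMem Ω |>.2 ⟨y, hy⟩)
  exact ⟨b, hb, hbd ▸ (Metric.infDist_le_dist_of_mem hy).trans_lt h⟩

theorem comparison_of_pos_dim (hd : 0 < d) (hΩ : IsOpen Ω) (hΩb : Bornology.IsBounded Ω)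
    (hG : ContDiff ℝ 1 G) (hG' : ∀ s, 0 < deriv G s) (hu : IsSuper Ω G u) (hv : IsSub Ω G v)
    (hinit : ∀ x ∈ closure Ω, v x 0 < u x 0)
    (hbdry : ∀ x ∈ frontier Ω, ∀ t, 0 ≤ t → v x t ≤ u x t)
    {x₁ : EuclideanSpace ℝ (Fin d)} (hx₁ : x₁ ∈ Ω) {T : ℝ} (hT : 0 < T) : v x₁ T ≤ u x₁ T := by
  by_contra! hlt
  have hGd : Differentiable ℝ G := hG.differentiable one_ne_zero
  have hGm : StrictMono G := strictMono_of_deriv_pos hG'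
  set K : Set (EuclideanSpace ℝ (Fin d) × ℝ) := closure Ω ×ˢ Icc 0 (T + 1) with hKdef
  have hK : IsCompact K := hΩb.isCompact_closure.prod isCompact_Icc
  have hKs : K ⊆ closure Ω ×ˢ Ici 0 := prod_mono le_rfl fun t ht => ht.1
  have huK := hu.cont.mono hKs
  have hvK := hv.cont.mono hKs
  obtain ⟨Mu, hMu⟩ := hK.exists_bound_of_continuousOn huK
  obtain ⟨Mv, hMv⟩ := hK.exists_bound_of_continuousOn hvK
  obtain ⟨φ, φ', hφ, hφ'u, ⟨m, hm, hφ'm⟩, ⟨L, hφ'L⟩, hφG⟩ :=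
    exists_uniform_left_inverse hG hG' (M := max 0 (max Mu Mv)) (le_max_left _ _)
  have hφm : StrictMono φ := strictMono_of_deriv_pos fun r => by
    rw [(hφ r).deriv]; exact hm.trans_le (hφ'm r)
  have hφc : Continuous φ := continuous_iff_continuousAt.2 fun r => (hφ r).continuousAt
  have hφu : ∀ p ∈ K, φ (G (u p.1 p.2)) = u p.1 p.2 := fun p hp => hφG _ (abs_le.1
    ((hMu p hp).trans ((le_max_left _ _).trans (le_max_right _ _))))
  have hφv : ∀ p ∈ K, φ (G (v p.1 p.2)) = v p.1 p.2 := fun p hp => hφG _ (abs_le.1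
    ((hMv p hp).trans ((le_max_right _ _).trans (le_max_right _ _))))
  obtain ⟨m₀, hm₀, hgap⟩ : ∃ m₀ > 0, ∀ x ∈ closure Ω, G (v x 0) + m₀ ≤ G (u x 0) := by
    have hc : ContinuousOn (fun x => G (u x 0) - G (v x 0)) (closure Ω) := by
      have h1 : ContinuousOn (fun x : EuclideanSpace ℝ (Fin d) => (x, (0 : ℝ))) (closure Ω) := by
        fun_prop
      have h2 : MapsTo (fun x : EuclideanSpace ℝ (Fin d) => (x, (0 : ℝ))) (closure Ω)
        (closure Ω ×ˢ Ici 0) := fun x hx => ⟨hx, mem_Ici.2 le_rfl⟩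
      exact (hGd.continuous.comp_continuousOn (hu.cont.comp h1 h2)).sub
        (hGd.continuous.comp_continuousOn (hv.cont.comp h1 h2))
    obtain ⟨x, hx, hmin⟩ := hΩb.isCompact_closure.exists_isMinOn
      ⟨x₁, subset_closure hx₁⟩ hc
    refine ⟨_, sub_pos.2 (hGm (hinit x hx)), fun y hy => ?_⟩
    have : G (u x 0) - G (v x 0) ≤ G (u y 0) - G (v y 0) := hmin hy
    linarith
  obtain ⟨w, hw, σ, hσ, hwσ⟩ : ∃ w > 0, ∃ σ > 0, ∀ x t, dist x x₁ < σ → |t - T| < σ →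
      w ≤ v x t - u x t := by
    have hnh : closure Ω ×ˢ Ici (0 : ℝ) ∈ 𝓝 (x₁, T) :=
      prod_mem_nhds (mem_of_superset (hΩ.mem_nhds hx₁) subset_closure) (Ici_mem_nhds hT)
    have hc := (hv.cont.continuousAt hnh).sub (hu.cont.continuousAt hnh)
    have hpos : 0 < v x₁ T - u x₁ T := sub_pos.2 hlt
    refine ⟨(v x₁ T - u x₁ T) / 2, by positivity, ?_⟩
    obtain ⟨σ, hσ, h⟩ := Metric.eventually_nhds_iff.1
      (hc.eventually (lt_mem_nhds (half_lt_self hpos)))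
    refine ⟨σ, hσ, fun x t hx ht => (h (y := (x, t)) ?_).le⟩
    rw [Prod.dist_eq, Real.dist_eq]
    exact max_lt hx ht
  obtain ⟨ρ₀, hρ₀, hρ₀Ω⟩ := Metric.isOpen_iff.1 hΩ x₁ hx₁
  set ρ := min (ρ₀ / 4) (σ / 2) with hρdef
  have hρ : 0 < ρ := lt_min (by positivity) (by positivity)
  have hρΩ : Metric.ball x₁ (4 * ρ) ⊆ Ω := (Metric.ball_subset_ball (by
    linarith [min_le_left (ρ₀ / 4) (σ / 2)])).trans hρ₀Ω
  obtain ⟨R₀, hR₀⟩ := hΩb.subset_closedBall x₁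
  set A := 3 * ρ ^ 2 / (2 * d) * w * volume.real (Metric.ball x₁ ρ) with hA
  have hApos : 0 < A := by
    have : 0 < volume.real (Metric.ball x₁ ρ) :=
      ENNReal.toReal_pos (Metric.measure_ball_pos _ _ hρ).ne' measure_ball_lt_top.ne
    have : (0 : ℝ) < d := by exact_mod_cast hd
    positivity
  set e := A / (T * volume.real Ω + 1) with he
  have hden : 0 < T * volume.real Ω + 1 := by positivity
  have hepos : 0 < e := by positivity
  set η := min e m₀ / 4 with hη
  have hmin : 0 < min e m₀ := lt_min hepos hm₀
  have hηpos : 0 < η := by positivity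
  have hηe : 2 * η ≤ e := by linarith [min_le_left e m₀]
  have hηm : 2 * η < m₀ := by linarith [min_le_right e m₀]
  obtain ⟨r₁, hr₁, hur₁⟩ := Metric.uniformContinuousOn_iff.1
    (hK.uniformContinuousOn_of_continuous (hGd.continuous.comp_continuousOn huK)) η hηpos
  obtain ⟨r₂, hr₂, hvr₂⟩ := Metric.uniformContinuousOn_iff.1
    (hK.uniformContinuousOn_of_continuous (hGd.continuous.comp_continuousOn hvK)) η hηpos
  obtain ⟨r, hr, hrr₁, hrr₂, hr1, hrρ, hrT, hrσ⟩ : ∃ r > 0, 3 * r ≤ r₁ ∧ 3 * r ≤ r₂ ∧ r ≤ 1 ∧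
      r ≤ ρ ∧ 2 * r ≤ T ∧ r < σ := by
    refine ⟨min (min (r₁ / 3) (r₂ / 3)) (min 1 (min ρ (min (T / 2) (σ / 2)))), by
      simp only [gt_iff_lt, lt_min_iff]; refine ⟨⟨?_, ?_⟩, ?_, ?_, ?_, ?_⟩ <;> positivity, ?_⟩
    set r := min (min (r₁ / 3) (r₂ / 3)) (min 1 (min ρ (min (T / 2) (σ / 2)))) with hr
    obtain ⟨⟨h1, h2⟩, h3, h4, h5, h6⟩ : (r ≤ r₁ / 3 ∧ r ≤ r₂ / 3) ∧ r ≤ 1 ∧ r ≤ ρ ∧ r ≤ T / 2 ∧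
      r ≤ σ / 2 := by simpa only [le_min_iff] using hr.le
    refine ⟨?_, ?_, h3, h4, ?_, ?_⟩ <;> linarith
  have huη : ∀ x ∈ closure Ω, ∀ y ∈ closure Ω, ∀ t ∈ Icc 0 (T + 1), ∀ s ∈ Icc 0 (T + 1),
      dist x y < 3 * r → |s - t| < 3 * r → G (u x t) ≤ G (u y s) + η := by
    intro x hx y hy t ht s hs hxy hst
    have := hur₁ (x, t) ⟨hx, ht⟩ (y, s) ⟨hy, hs⟩ (by
      rw [Prod.dist_eq, Real.dist_eq, abs_sub_comm]
      exact max_lt (hxy.trans_le hrr₁) (hst.trans_le hrr₁))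
    rw [Real.dist_eq, abs_lt] at this
    simp only [Function.comp] at this
    linarith [this.2]
  have hvη : ∀ x ∈ closure Ω, ∀ y ∈ closure Ω, ∀ t ∈ Icc 0 (T + 1), ∀ s ∈ Icc 0 (T + 1),
      dist x y < 3 * r → |s - t| < 3 * r → G (v x t) ≤ G (v y s) + η := by
    intro x hx y hy t ht s hs hxy hst
    have := hvr₂ (x, t) ⟨hx, ht⟩ (y, s) ⟨hy, hs⟩ (by
      rw [Prod.dist_eq, Real.dist_eq, abs_sub_comm]
      exact max_lt (hxy.trans_le hrr₂) (hst.trans_le hrr₂))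
    rw [Real.dist_eq, abs_lt] at this
    simp only [Function.comp] at this
    linarith [this.2]
  obtain ⟨Q, hQc, hQge, ⟨CQ, hQC⟩, ⟨BQ, hQB⟩, hQ⟩ := hv.exists_supConv hΩ hΩb ⟨x₁, hx₁⟩ hGd hT.le
    hφ hφ'u hm hφ'm hφ'L hφv hr hr1
  have hψ : ∀ r, HasDerivAt (fun r => -φ (-r)) (φ' (-r)) r := fun r => by
    simpa using ((hφ (-r)).comp r (hasDerivAt_neg r)).fun_neg
  obtain ⟨P, hPc, hPge, ⟨CP, hPC⟩, ⟨BP, hPB⟩, hP⟩ := hu.neg.exists_supConv hΩ hΩb ⟨x₁, hx₁⟩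
    (hG.oddReflect.differentiable one_ne_zero) hT.le hψ
    (hφ'u.comp uniformContinuous_neg) hm (fun r => hφ'm _) (fun r => hφ'L _)
    (fun p hp => by simp only [oddReflect, neg_neg]; rw [hφu p hp]) hr hr1
  simp only [oddReflect, neg_neg] at hPge hP
  have hTmem : ∀ t, t ≤ T → t ≤ T + 1 := fun t ht => by linarith
  set Ω' := (Metric.cthickening r Ωᶜ)ᶜ with hΩ'
  have hΩ'Ω : Ω' ⊆ Ω := fun x hx => by
    by_contra h
    exact hx (Metric.self_subset_cthickening _ h)
  have hΩ'far : ∀ x ∈ Ω', ∀ y, dist x y ≤ r → y ∈ Ω := fun x hx y hxy => by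
    by_contra h
    exact hx (Metric.mem_cthickening_of_dist_le x y r _ h hxy)
  have hcore := weighted_l1_estimate (Ω := Ω') (x₁ := x₁) (ρ := ρ) (R := max R₀ (2 * ρ))
    (X := fun x t => φ (Q x t) - φ (-P x t)) (z := fun x t => Q x t + P x t) (t₁ := 2 * r) (T := T)
    (e := e) (h₀ := r) (w := w) (C := BQ + BP) (Cz := CQ + CP) hd
    Metric.isClosed_cthickening.isOpen_compl.measurableSet hρ ?_
    ((hΩ'Ω.trans hR₀).trans (Metric.closedBall_subset_closedBall (le_max_left _ _)))
    (le_max_right _ _) ((hφc.comp hQc).sub (hφc.comp hPc.neg)) (hQc.add hPc)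
    (fun x t => by rw [sub_pos, hφm.lt_iff_lt]; constructor <;> intro h <;> linarith)
    hrT hepos.le hr hw.le (fun x t => add_le_add (hQC x t) (hPC x t)) ?_ ?_ ?_ ?_ ?_
  · rw [← hA] at hcore
    have h1 : e * (T - 2 * r) * volume.real Ω' ≤ e * T * volume.real Ω := by
      have h2 : volume.real Ω' ≤ volume.real Ω := measureReal_mono hΩ'Ω hΩb.measure_lt_top.ne
      have h3 : e * (T - 2 * r) ≤ e * T := by nlinarith
      exact mul_le_mul h3 h2 measureReal_nonneg (by positivity)
    have h4 : e * (T * volume.real Ω + 1) = A := by rw [he]; field_simp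
    linarith
  · intro x hx hxc
    obtain ⟨b, hb, hxb⟩ := Metric.mem_thickening_iff.1
      (Metric.cthickening_subset_thickening' (by positivity) (by linarith : r < 2 * r) _ hxc)
    refine hb (hρΩ ?_)
    rw [Metric.mem_ball] at hx ⊢
    have := dist_triangle b x x₁
    rw [dist_comm b x] at this
    linarith
  · intro x hx t ht hz ε hε
    have hxc := subset_closure (hΩ'Ω hx)
    have ht0 : t ∈ Icc 0 T := ⟨by linarith [ht.1], ht.2⟩
    obtain ⟨y, hy, s, hs, hxy, hst, hQs, hQi⟩ := hQ x hxc t ht0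
    obtain ⟨y', hy', s', hs', hxy', hst', hPs, hPi⟩ := hP x hxc t ht0
    have hyΩ := hΩ'far x hx y hxy.le
    have hyΩ' := hΩ'far x hx y' hxy'.le
    have hs0 : 0 < s := by linarith [(abs_lt.1 hst).1, ht.1]
    have hs0' : 0 < s' := by linarith [(abs_lt.1 hst').1, ht.1]
    have h1 : u y' s' < v y s := hGm.lt_iff_lt.1 (by linarith)
    have h00 : (0 : ℝ) ∈ Icc 0 (T + 1) := ⟨le_rfl, by linarith⟩
    have h0 : v y 0 < u y' 0 := by
      refine hGm.lt_iff_lt.1 ?_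
      have h2 := hvη y hy x hxc 0 h00 0 h00 (by rw [dist_comm]; linarith) (by simpa using hr)
      have h3 := huη x hxc y' hy' 0 h00 0 h00 (by linarith) (by simpa using hr)
      linarith [hgap x hxc]
    have hq := hQi hyΩ hs0 (hv.differentiableAt_fderiv_of_lt hΩ hG hG' hu hyΩ' hyΩ hs0' hs0 h0 h1)
      (ε / 2) (by positivity)
    have hp := hPi hyΩ' hs0' (fun e => differentiableAt_fderiv_fun_neg
      (hu.differentiableAt_fderiv_of_lt hΩ hG hG' hv hyΩ' hyΩ hs0' hs0 h0 h1 e))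
      (ε / 2) (by positivity)
    filter_upwards [hq, hp] with h hqh hph
    rw [discLap_add]
    have : (φ (Q x t) - φ (-P x t) - (φ (Q x (t - h)) - φ (-P x (t - h)))) / h =
      (φ (Q x t) - φ (Q x (t - h))) / h + (-φ (-P x t) - -φ (-P x (t - h))) / h := by ring
    rw [this]
    linarith
  · intro x hx t ht _ h hh hhr
    have ht0 : t ∈ Icc 0 T := ⟨by linarith [ht.1], ht.2⟩
    have hqh := hQB x t ht0 h hh (by linarith [ht.1])
    have hph := hPB x t ht0 h hh (by linarith [ht.1])
    rw [discLap_add]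
    have : (φ (Q x t) - φ (-P x t) - (φ (Q x (t - h)) - φ (-P x (t - h)))) / h =
      (φ (Q x t) - φ (Q x (t - h))) / h + (-φ (-P x t) - -φ (-P x (t - h))) / h := by ring
    rw [this]
    linarith
  · intro x hx t ht
    have hxc := subset_closure (hΩ'Ω hx)
    obtain ⟨y, hy, s, hs, hxy, hst, hQs, -⟩ := hQ x hxc t ⟨by linarith [ht.1], by linarith [ht.2]⟩
    obtain ⟨y', hy', s', hs', hxy', hst', hPs, -⟩ :=
      hP x hxc t ⟨by linarith [ht.1], by linarith [ht.2]⟩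
    have h00 : (0 : ℝ) ∈ Icc 0 (T + 1) := ⟨le_rfl, by linarith⟩
    have hs3 : |0 - s| < 3 * r := by
      rw [zero_sub, abs_neg, abs_of_nonneg hs.1]; linarith [(abs_lt.1 hst).2, ht.2]
    have hs3' : |s' - 0| < 3 * r := by
      rw [sub_zero, abs_of_nonneg hs'.1]; linarith [(abs_lt.1 hst').2, ht.2]
    have h2 := hvη y hy x hxc s hs 0 h00 (by rw [dist_comm]; linarith) hs3
    have h3 := huη x hxc y' hy' 0 h00 s' hs' (by linarith) hs3'
    rw [sub_nonpos, hφm.le_iff_le]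
    linarith [hgap x hxc]
  · rintro x hx ⟨y₀, hy₀, hxy₀⟩ t ht
    have hxΩ : x ∈ Ω := hΩ'far y₀ hy₀ x (by rwa [dist_comm])
    have hxc := subset_closure hxΩ
    have ht0 : t ∈ Icc 0 T := ⟨by linarith [ht.1], ht.2⟩
    have ht1 : t ∈ Icc 0 (T + 1) := ⟨ht0.1, hTmem t ht.2⟩
    obtain ⟨c, hc, hxc'⟩ := Metric.mem_thickening_iff.1
      (Metric.cthickening_subset_thickening' (by positivity) (by linarith : r < 2 * r) _
        (not_notMem.1 hx))
    obtain ⟨b, hb, hxb⟩ := exists_frontier_dist_lt hxΩ hc hxc'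
    have hbc := frontier_subset_closure hb
    obtain ⟨y, hy, s, hs, hxy, hst, hQs, -⟩ := hQ x hxc t ht0
    obtain ⟨y', hy', s', hs', hxy', hst', hPs, -⟩ := hP x hxc t ht0
    have h2 := hvη y hy b hbc s hs t ht1 (by
      have := dist_triangle y x b
      rw [dist_comm y x] at this
      linarith) (by rw [abs_sub_comm]; linarith)
    have h3 := huη b hbc y' hy' t ht1 s' hs' (by
      have := dist_triangle b x y'
      rw [dist_comm b x] at this
      linarith) (by linarith)
    have h4 := hGm.monotone (hbdry b hb t ht0.1)
    linarith
  · intro x hx t ht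
    rw [Metric.mem_ball] at hx
    have hxc : x ∈ closure Ω := subset_closure (hρΩ (by rw [Metric.mem_ball]; linarith))
    have ht0 : t ∈ Icc 0 T := ⟨by linarith [ht.1], ht.2⟩
    have hmem : (x, t) ∈ K := ⟨hxc, ht0.1, hTmem t ht.2⟩
    have h1 := hφm.monotone (hQge x hxc t ht0)
    have h2 : φ (-P x t) ≤ φ (G (u x t)) := hφm.monotone (by linarith [hPge x hxc t ht0])
    have h3 := hφv _ hmem
    have h4 := hφu _ hmem
    have h5 := hwσ x t (by linarith [min_le_right (ρ₀ / 4) (σ / 2)])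
      (by rw [abs_lt]; constructor <;> linarith [ht.1, ht.2])
    simp only at h3 h4
    linarith

end Comparison

/-! ### The comparison principle -/

theorem comparison_of_dim_zero {Ω : Set (EuclideanSpace ℝ (Fin 0))} {G : ℝ → ℝ}
    {u v : EuclideanSpace ℝ (Fin 0) → ℝ → ℝ} (hu : IsSuper Ω G u) (hv : IsSub Ω G v)
    (hinit : ∀ x ∈ closure Ω, v x 0 < u x 0) {x : EuclideanSpace ℝ (Fin 0)} (hx : x ∈ Ω)
    {t : ℝ} (ht : 0 < t) : v x t ≤ u x t := by
  have hc : ContinuousOn (fun t : ℝ => (x, t)) (Ici 0) := by fun_prop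
  have hm : MapsTo (fun t : ℝ => (x, t)) (Ici 0) (closure Ω ×ˢ Ici 0) :=
    fun t ht => ⟨subset_closure hx, ht⟩
  have hu1 : MonotoneOn (u x) (Ici 0) := by
    refine monotoneOn_of_deriv_nonneg (convex_Ici 0) (hu.cont.comp hc hm)
      (fun s hs => ?_) fun s hs => ?_ <;> rw [interior_Ici] at hs
    · exact (hu.time x hx s hs).differentiableWithinAt
    · simpa [laplacian] using hu.ineq x hx s hs
  have hv1 : AntitoneOn (v x) (Ici 0) := by
    refine antitoneOn_of_deriv_nonpos (convex_Ici 0) (hv.cont.comp hc hm)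
      (fun s hs => ?_) fun s hs => ?_ <;> rw [interior_Ici] at hs
    · exact (hv.time x hx s hs).differentiableWithinAt
    · simpa [laplacian] using hv.ineq x hx s hs
  have h0 : (0 : ℝ) ∈ Ici (0 : ℝ) := mem_Ici.2 le_rfl
  exact (hv1 h0 ht.le ht.le).trans ((hinit x (subset_closure hx)).le.trans (hu1 h0 ht.le ht.le))

/-- Comparison (maximum) principle for the filtration equation `∂E/∂t = -Δ β(E)` with a
strictly decreasing `C¹` function `β`: a supersolution initially above a subsolution, and
above it on the lateral boundary, stays above it. -/
theorem comparison_principle_filtration {d : ℕ}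
    (Ω : Set (EuclideanSpace ℝ (Fin d)))
    (hΩopen : IsOpen Ω) (hΩbdd : Bornology.IsBounded Ω)
    (β : ℝ → ℝ) (hβ : ContDiff ℝ 1 β) (hβ' : ∀ s : ℝ, deriv β s < 0)
    (u v : EuclideanSpace ℝ (Fin d) → ℝ → ℝ)
    (hucont : ContinuousOn (fun p : EuclideanSpace ℝ (Fin d) × ℝ => u p.1 p.2)
      (closure Ω ×ˢ Ici (0 : ℝ)))
    (hvcont : ContinuousOn (fun p : EuclideanSpace ℝ (Fin d) × ℝ => v p.1 p.2)
      (closure Ω ×ˢ Ici (0 : ℝ)))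
    (hux : ∀ t ∈ Ioi (0 : ℝ), ∀ x ∈ Ω, ContDiffAt ℝ 2 (fun y => u y t) x)
    (hvx : ∀ t ∈ Ioi (0 : ℝ), ∀ x ∈ Ω, ContDiffAt ℝ 2 (fun y => v y t) x)
    (hut : ∀ x ∈ Ω, ∀ t ∈ Ioi (0 : ℝ), ContDiffAt ℝ 1 (fun τ => u x τ) t)
    (hvt : ∀ x ∈ Ω, ∀ t ∈ Ioi (0 : ℝ), ContDiffAt ℝ 1 (fun τ => v x τ) t)
    (hsuper : ∀ x ∈ Ω, ∀ t ∈ Ioi (0 : ℝ),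
      - laplacian (fun y => β (u y t)) x ≤ deriv (fun τ => u x τ) t)
    (hsub : ∀ x ∈ Ω, ∀ t ∈ Ioi (0 : ℝ),
      deriv (fun τ => v x τ) t ≤ - laplacian (fun y => β (v y t)) x)
    (hinit : ∀ x ∈ closure Ω, v x 0 < u x 0)
    (hbdry : ∀ x ∈ frontier Ω, ∀ t ∈ Ici (0 : ℝ), v x t ≤ u x t) :
    ∀ x ∈ Ω, ∀ t ∈ Ioi (0 : ℝ), v x t ≤ u x t := by
  have hG : ContDiff ℝ 1 fun s => -β s := hβ.neg
  have hG' : ∀ s, 0 < deriv (fun s => -β s) s := fun s => by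
    rw [deriv.fun_neg]; exact neg_pos.2 (hβ' s)
  have hu : IsSuper Ω (fun s => -β s) u :=
    ⟨hucont, hux, fun x hx t ht => (hut x hx t ht).differentiableAt one_ne_zero,
      fun x hx t ht => (laplacian_neg _ x).trans_le (hsuper x hx t ht)⟩
  have hv : IsSub Ω (fun s => -β s) v :=
    ⟨hvcont, hvx, fun x hx t ht => (hvt x hx t ht).differentiableAt one_ne_zero,
      fun x hx t ht => (hsub x hx t ht).trans_eq (laplacian_neg _ x).symm⟩
  intro x hx t ht
  obtain rfl | hd := d.eq_zero_or_pos
  · exact comparison_of_dim_zero hu hv hinit hx ht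
  · exact comparison_of_pos_dim hd hΩopen hΩbdd hG hG' hu hv hinit hbdry hx ht
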